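/- arXiv:1302.0541 — 3 statements merged into one kernel-verified Lean document; each statement's English description precedes it below -/
import Mathlib

section
/- Let Γ ⊂ ℝⁿ (n ≥ 2) be an open convex cone with vertex at the origin (0 ∉ Γ, and tλ ∈ Γ whenever t > 0 and λ ∈ Γ), invariant under permutations of the coordinates, and containing the positive cone Γ⁺ = {λ ∈ ℝⁿ : λᵢ > 0 for all i}. Then every λ ∈ Γ satisfies λ₁ + λ₂ + ⋯ + λₙ > 0; that is, Γ ⊂ {λ ∈ ℝⁿ : λ₁ + ⋯ + λₙ > 0}. -/
open scoped RealInnerProductSpace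
open Set

noncomputable section

/-- Euclidean `n`-space. -/
abbrev E (n : ℕ) := EuclideanSpace ℝ (Fin n)

/-- The Euclidean Hessian bilinear form at `x` of (the 0-homogeneous extension of) a
function `ρ` on the sphere, evaluated on the pair of vectors `(u, w)`. -/
def hess {n : ℕ} (ρ : E n → ℝ) (x u w : E n) : ℝ :=
  ⟪fderiv ℝ (gradient ρ) x u, w⟫

/-- The induced metric `g` of the starshaped hypersurface with radial function `ρ`,
as a bilinear form on the tangent space `x^⊥`. -/
def gForm {n : ℕ} (ρ : E n → ℝ) (x u w : E n) : ℝ :=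
  (ρ x) ^ 2 * ⟪u, w⟫ + ⟪gradient ρ x, u⟫ * ⟪gradient ρ x, w⟫

/-- The second fundamental form `h` of the starshaped hypersurface with radial function `ρ`,
as a bilinear form on the tangent space `x^⊥`. -/
def hForm {n : ℕ} (ρ : E n → ℝ) (x u w : E n) : ℝ :=
  ((ρ x) ^ 2 * ⟪u, w⟫ + 2 * ⟪gradient ρ x, u⟫ * ⟪gradient ρ x, w⟫
      - ρ x * hess ρ x u w) / Real.sqrt ((ρ x) ^ 2 + ‖gradient ρ x‖ ^ 2)

/-- `κ : Fin n → ℝ` is (an ordering of) the vector of principal curvatures at the point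
`ρ(x)·x` of the starshaped hypersurface with radial function `ρ` : the generalized
eigenvalues of the second fundamental form `h` with respect to the metric `g` on the
tangent space `x^⊥` (equivalently, the eigenvalues of the matrix `a = b·h·b`). -/
def HasPrincCurv {n : ℕ} (ρ : E (n + 1) → ℝ) (x : E (n + 1)) (κ : Fin n → ℝ) : Prop :=
  ∃ w : Fin n → E (n + 1), LinearIndependent ℝ w ∧ (∀ i, ⟪x, w i⟫ = 0) ∧
    ∀ i, ∀ u : E (n + 1), ⟪x, u⟫ = 0 →
      hForm ρ x u (w i) = κ i * gForm ρ x u (w i)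

/-- A radial function `ρ` is admissible if its principal curvature vector lies in `Γ`
at every point of the sphere. -/
def Admissible {n : ℕ} (Γ : Set (Fin n → ℝ)) (ρ : E (n + 1) → ℝ) : Prop :=
  ∀ x : E (n + 1), ‖x‖ = 1 → ∃ κ ∈ Γ, HasPrincCurv ρ x κ

/-- The value `𝓕[ρ](x)` of the flow operator, expressed through a principal
curvature vector `κ` of `ρ` at `x`. -/
def calF {n : ℕ} (F : (Fin n → ℝ) → ℝ) (f : E (n + 1) → ℝ)
    (ρ : E (n + 1) → ℝ) (x : E (n + 1)) (κ : Fin n → ℝ) : ℝ :=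
  (1 / F κ - f (ρ x • x)) * Real.sqrt ((ρ x) ^ 2 + ‖gradient ρ x‖ ^ 2) / ρ x

/-- `Γ` is an open convex symmetric cone with vertex at the origin containing the
positive cone. -/
def GoodCone {n : ℕ} (Γ : Set (Fin n → ℝ)) : Prop :=
  IsOpen Γ ∧ Convex ℝ Γ ∧ 0 ∉ Γ ∧
    (∀ t : ℝ, ∀ l ∈ Γ, 0 < t → t • l ∈ Γ) ∧
    (∀ σ : Equiv.Perm (Fin n), ∀ l ∈ Γ, l ∘ σ ∈ Γ) ∧
    (∀ l : Fin n → ℝ, (∀ i, 0 < l i) → l ∈ Γ)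

/-- Structure conditions (1.3)-(1.6) on the curvature function `F`:
positivity, smoothness, symmetry, monotonicity, homogeneity of degree `k`,
log-concavity and normalization. -/
def GoodF {n : ℕ} (Γ : Set (Fin n → ℝ)) (F : (Fin n → ℝ) → ℝ) (k : ℝ) : Prop :=
  (∀ l ∈ Γ, 0 < F l) ∧ ContDiffOn ℝ (⊤ : ℕ∞) F Γ ∧
    (∀ σ : Equiv.Perm (Fin n), ∀ l ∈ Γ, F (l ∘ σ) = F l) ∧
    (∀ l ∈ Γ, ∀ i, 0 < fderiv ℝ F l (Pi.single i 1)) ∧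
    (∀ t : ℝ, ∀ l ∈ Γ, 0 < t → F (t • l) = t ^ k * F l) ∧
    ConcaveOn ℝ Γ (fun l => Real.log (F l)) ∧
    F (fun _ => 1) = 1

/-- `F` extends continuously by `0` to the boundary of `Γ`. -/
def FVanishesOnBoundary {n : ℕ} (Γ : Set (Fin n → ℝ)) (F : (Fin n → ℝ) → ℝ) : Prop :=
  ∀ l ∈ frontier Γ, Filter.Tendsto F (nhdsWithin l Γ) (nhds 0)

/-- Conditions (1.7)-(1.8) on the prescribed function `f`. -/
def GoodPrescribed {n : ℕ} (f : E (n + 1) → ℝ) (k r₁ r₂ : ℝ) : Prop :=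
  ContDiffOn ℝ (⊤ : ℕ∞) f {X | X ≠ 0} ∧ (∀ X : E (n + 1), X ≠ 0 → 0 < f X) ∧
    (∀ x : E (n + 1), ‖x‖ = 1 → ∀ r : ℝ, 0 < r →
      0 < deriv (fun s : ℝ => s ^ (-k) * f (s • x)) r) ∧
    0 < r₁ ∧ r₁ ≤ r₂ ∧
    (∀ X : E (n + 1), ‖X‖ = r₁ → f X ≤ r₁ ^ k) ∧
    (∀ X : E (n + 1), ‖X‖ = r₂ → r₂ ^ k ≤ f X)

/-- A smooth positive function on the sphere, given by its 0-homogeneous extension. -/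
def GoodInit {n : ℕ} (ρ₀ : E (n + 1) → ℝ) : Prop :=
  ContDiffOn ℝ (⊤ : ℕ∞) ρ₀ {y | y ≠ 0} ∧
    (∀ c : ℝ, 0 < c → ∀ y : E (n + 1), ρ₀ (c • y) = ρ₀ y) ∧
    (∀ x : E (n + 1), ‖x‖ = 1 → 0 < ρ₀ x)

/-- `ρ` is an admissible solution on `[0,T]` of the flow `∂ₜρ = 𝓕[ρ(t,·)]` (the radial
formulation (2.10) of the curvature flow (1.2)) with initial datum `ρ₀`. -/
def IsFlowSol {n : ℕ} (Γ : Set (Fin n → ℝ)) (F : (Fin n → ℝ) → ℝ)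
    (f : E (n + 1) → ℝ) (T : ℝ) (ρ : ℝ → E (n + 1) → ℝ) (ρ₀ : E (n + 1) → ℝ) : Prop :=
  ContDiffOn ℝ (⊤ : ℕ∞) (fun p : ℝ × E (n + 1) => ρ p.1 p.2) (univ ×ˢ {y | y ≠ 0}) ∧
    (∀ t ∈ Icc (0 : ℝ) T, ∀ c : ℝ, 0 < c → ∀ y : E (n + 1), ρ t (c • y) = ρ t y) ∧
    (∀ t ∈ Icc (0 : ℝ) T, ∀ x : E (n + 1), ‖x‖ = 1 → 0 < ρ t x) ∧
    (∀ t ∈ Icc (0 : ℝ) T, Admissible Γ (ρ t)) ∧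
    (∀ t ∈ Icc (0 : ℝ) T, ∀ x : E (n + 1), ‖x‖ = 1 → ∀ κ : Fin n → ℝ,
      HasPrincCurv (ρ t) x κ → deriv (fun s => ρ s x) t = calF F f (ρ t) x κ) ∧
    (∀ x : E (n + 1), ‖x‖ = 1 → ρ 0 x = ρ₀ x)

/-- Minimum of a function over the unit sphere. -/
def sphMin {n : ℕ} (u : E (n + 1) → ℝ) : ℝ := sInf (u '' {x : E (n + 1) | ‖x‖ = 1})

/-- Maximum of a function over the unit sphere. -/
def sphMax {n : ℕ} (u : E (n + 1) → ℝ) : ℝ := sSup (u '' {x : E (n + 1) | ‖x‖ = 1})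

/-- The `C^m`-norm on the sphere of a function, computed through the Euclidean
derivatives of its 0-homogeneous extension. -/
def CmNorm {n : ℕ} (m : ℕ) (u : E (n + 1) → ℝ) : ℝ :=
  ∑ j ∈ Finset.range (m + 1),
    sSup ((fun x => ‖iteratedFDeriv ℝ j u x‖) '' {x : E (n + 1) | ‖x‖ = 1})


/-- an open convex permutation-invariant cone containing the positive cone
is contained in the half-space where the sum of the coordinates is positive. -/
theorem stmt0 (n : ℕ) (hn : 2 ≤ n) (Γ : Set (Fin n → ℝ))
    (hopen : IsOpen Γ) (hconv : Convex ℝ Γ) (h0 : 0 ∉ Γ)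
    (hcone : ∀ t : ℝ, ∀ l ∈ Γ, 0 < t → t • l ∈ Γ)
    (hsym : ∀ σ : Equiv.Perm (Fin n), ∀ l ∈ Γ, l ∘ σ ∈ Γ)
    (hposcone : ∀ l : Fin n → ℝ, (∀ i, 0 < l i) → l ∈ Γ) :
    ∀ l ∈ Γ, 0 < ∑ i, l i := by
  intro l hl
  have : NeZero n := ⟨by omega⟩
  have hnpos : (0 : ℝ) < n := by
    have : 0 < n := by omega
    exact_mod_cast this
  have hm : (∑ k : Fin n, ((n : ℝ)⁻¹) • (l ∘ (Equiv.addLeft k))) ∈ Γ := by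
    apply hconv.sum_mem
    · intro i _
      positivity
    · simp [hnpos.ne']
    · intro i _
      exact hsym _ l hl
  have he : (∑ k : Fin n, ((n : ℝ)⁻¹) • (l ∘ (Equiv.addLeft k)))
      = fun _ => (n : ℝ)⁻¹ * ∑ i, l i := by
    funext j
    simp only [Finset.sum_apply, Pi.smul_apply, smul_eq_mul, Function.comp, Equiv.coe_addLeft]
    rw [← Finset.mul_sum]
    congr 1
    exact Equiv.sum_comp (Equiv.addRight j) l
  rw [he] at hm
  by_contra hs
  rw [not_lt] at hs
  rcases hs.eq_or_lt with hs | hs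
  · rw [hs] at hm
    apply h0
    rw [mul_zero] at hm
    exact hm
  · have hp : (fun _ : Fin n => -((n : ℝ)⁻¹ * ∑ i, l i)) ∈ Γ := by
      apply hposcone
      intro _
      have := mul_neg_of_pos_of_neg (inv_pos.mpr hnpos) hs
      linarith
    have hz := hconv hm hp (a := 1 / 2) (b := 1 / 2) (by norm_num) (by norm_num) (by norm_num)
    apply h0
    convert hz using 1
    funext j
    simp
end
end

section
/- Assume: Γ ⊂ ℝⁿ (n ≥ 2) is an open convex cone with vertex at the origin, permutation-invariant, containing the positive cone Γ⁺; F : Γ → ℝ is positive, symmetric, smooth on Γ, extends continuously by 0 to ∂Γ, has ∂F/∂λᵢ > 0 on Γ for every i, is positively homogeneous of degree k > 0, log F is concave on Γ, and F(1,…,1) = 1; f : ℝ^{n+1}∖{0} → (0,∞) is smooth, for every unit vector x the function ρ ↦ ρ^{−k}f(ρx) has strictly positive derivative on (0,∞), and there exist 0 < r₁ ≤ r₂ with f(X) ≤ r₁ᵏ whenever |X| = r₁ and f(X) ≥ r₂ᵏ whenever |X| = r₂. Let T > 0 and let ρ : [0,T]×Sⁿ → (0,∞) be an admissible solution of the flow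 ∂ₜρ = 𝓕[ρ(t,·)] with initial datum ρ₀ = ρ(0,·). Then R₁ ≤ ρ(t,x) ≤ R₂ for all (t,x) ∈ [0,T]×Sⁿ, where R₁ = min(r₁, min_{Sⁿ}ρ₀) and R₂ = max(r₂, max_{Sⁿ}ρ₀). -/
open scoped RealInnerProductSpace
open Set

noncomputable section

lemma aux_second_max {φ : ℝ → ℝ} (hm : IsLocalMax φ 0) (hc : ContinuousAt φ 0) :
    deriv (deriv φ) 0 ≤ 0 := by
  by_contra! hpos
  have h1 : deriv φ 0 = 0 := hm.deriv_eq_zero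
  have hmin : IsLocalMin φ 0 := isLocalMin_of_deriv_deriv_pos hpos h1 hc
  have he : φ =ᶠ[nhds 0] fun _ => φ 0 := by
    filter_upwards [hm, hmin] with s a b using le_antisymm a b
  have h2 : deriv (deriv φ) 0 = 0 := by
    rw [he.deriv.deriv_eq]; simp
  linarith

lemma aux_second_min {φ : ℝ → ℝ} (hm : IsLocalMin φ 0) (hc : ContinuousAt φ 0) :
    0 ≤ deriv (deriv φ) 0 := by
  have h := aux_second_max (φ := fun s => - φ s) hm.neg hc.neg
  have e : deriv (fun s => - φ s) = fun s => - deriv φ s := by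
    funext s; exact deriv.fun_neg
  rw [e, deriv.fun_neg] at h
  linarith

lemma aux_hess {n : ℕ} (ρ : E n → ℝ) (x w : E n) (h : ContDiffAt ℝ 2 ρ x) :
    deriv (deriv (fun s : ℝ => ρ (x + s • w))) 0 = hess ρ x w w := by
  have hline : ∀ s : ℝ, HasDerivAt (fun s : ℝ => x + s • w) w s := by
    intro s
    simpa using ((hasDerivAt_id s).smul_const w).const_add x
  have hev : ∀ᶠ y in nhds x, DifferentiableAt ℝ ρ y := by
    filter_upwards [h.eventually (by simp)] with y hy using hy.differentiableAt (by simp)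
  have hcont : Filter.Tendsto (fun s : ℝ => x + s • w) (nhds 0) (nhds x) := by
    have := (hline 0).continuousAt.tendsto
    simpa using this
  have e : deriv (fun s : ℝ => ρ (x + s • w)) =ᶠ[nhds 0]
      fun s => ⟪gradient ρ (x + s • w), w⟫ := by
    filter_upwards [hcont.eventually hev] with s hs
    have := hs.hasGradientAt.hasFDerivAt.comp_hasDerivAt s (hline s)
    simpa [Function.comp_def] using this.deriv
  rw [e.deriv_eq]
  have hg : DifferentiableAt ℝ (gradient ρ) x := by
    have h1 : DifferentiableAt ℝ (fderiv ℝ ρ) x :=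
      (h.fderiv_right (m := 1) (by norm_num)).differentiableAt (by simp)
    exact ((InnerProductSpace.toDual ℝ (E n)).symm.toContinuousLinearEquiv.differentiableAt).comp x h1
  have hg' : HasFDerivAt (gradient ρ) (fderiv ℝ (gradient ρ) x) (x + (0:ℝ) • w) := by
    simpa using hg.hasFDerivAt
  have h3 := (hg'.comp_hasDerivAt 0 (hline 0)).inner ℝ (hasDerivAt_const (0:ℝ) w)
  have := h3.deriv
  simp only [Function.comp_def] at this
  rw [this]
  simp [hess]

lemma aux_tend {n : ℕ} (x w : E n) :
    Filter.Tendsto (fun s : ℝ => x + s • w) (nhds 0) (nhds (x + (0:ℝ) • w)) := by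
  have : Continuous (fun s : ℝ => x + s • w) := by fun_prop
  exact this.tendsto 0

lemma aux_hess_max {n : ℕ} (ρ : E n → ℝ) (x w : E n) (h : ContDiffAt ℝ 2 ρ x)
    (hm : IsLocalMax ρ x) : hess ρ x w w ≤ 0 := by
  rw [← aux_hess ρ x w h]
  have ht := aux_tend x w
  have hx : x + (0:ℝ) • w = x := by simp
  apply aux_second_max
  · have := ht.eventually (p := fun y => ρ y ≤ ρ x) (by rw [hx]; exact hm)
    filter_upwards [this] with s hs
    simpa using hs
  · have hc : ContinuousAt ρ (x + (0:ℝ) • w) := by rw [hx]; exact h.continuousAt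
    exact Filter.Tendsto.comp hc ht

lemma aux_hess_min {n : ℕ} (ρ : E n → ℝ) (x w : E n) (h : ContDiffAt ℝ 2 ρ x)
    (hm : IsLocalMin ρ x) : 0 ≤ hess ρ x w w := by
  rw [← aux_hess ρ x w h]
  have ht := aux_tend x w
  have hx : x + (0:ℝ) • w = x := by simp
  apply aux_second_min
  · have := ht.eventually (p := fun y => ρ x ≤ ρ y) (by rw [hx]; exact hm)
    filter_upwards [this] with s hs
    simpa using hs
  · have hc : ContinuousAt ρ (x + (0:ℝ) • w) := by rw [hx]; exact h.continuousAt
    exact Filter.Tendsto.comp hc ht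

lemma aux_grad {n : ℕ} {ρ : E n → ℝ} {x : E n} (h : fderiv ℝ ρ x = 0) : gradient ρ x = 0 := by
  simp [gradient, h]

/-- curvature formula at a critical point -/
lemma aux_curv {n : ℕ} {ρ : E (n+1) → ℝ} {x : E (n+1)} {κ : Fin n → ℝ}
    (hg : gradient ρ x = 0) (hpos : 0 < ρ x) (hκ : HasPrincCurv ρ x κ) (i : Fin n) :
    ∃ w : E (n+1), 0 < ‖w‖ ^ 2 ∧ (κ i - 1 / ρ x) * (ρ x * ‖w‖ ^ 2) = - (hess ρ x w w / ρ x) := by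
  obtain ⟨w, hl, hw, he⟩ := hκ
  refine ⟨w i, ?_, ?_⟩
  · have := norm_pos_iff.mpr (hl.ne_zero i)
    positivity
  · have h := he i (w i) (hw i)
    simp only [hForm, gForm, hg, inner_zero_left, real_inner_self_eq_norm_sq, norm_zero] at h
    have hs : Real.sqrt (ρ x ^ 2 + 0 ^ 2) = ρ x := by
      rw [show ρ x ^ 2 + (0:ℝ) ^ 2 = ρ x ^ 2 by ring]; exact Real.sqrt_sq hpos.le
    rw [hs] at h
    field_simp at h ⊢
    apply mul_left_cancel₀ hpos.ne'
    linarith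

lemma aux_mono {n : ℕ} {Γ : Set (Fin n → ℝ)} (hΓ : GoodCone Γ) {F : (Fin n → ℝ) → ℝ} {k : ℝ}
    (hF : GoodF Γ F k) {a b : Fin n → ℝ} (ha : a ∈ Γ) (hb : b ∈ Γ) (hab : ∀ i, a i ≤ b i) :
    F a ≤ F b := by
  obtain ⟨ho, hconv, -⟩ := hΓ
  obtain ⟨-, hsm, -, hd, -⟩ := hF
  have hmem : ∀ s ∈ Icc (0:ℝ) 1, a + s • (b - a) ∈ Γ := fun s hs =>
    hconv.add_smul_sub_mem ha hb hs
  have hder : ∀ s ∈ Icc (0:ℝ) 1, HasDerivAt (fun s : ℝ => F (a + s • (b - a)))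
      (fderiv ℝ F (a + s • (b - a)) (b - a)) s := by
    intro s hs
    have h1 : DifferentiableAt ℝ F (a + s • (b - a)) :=
      (hsm.contDiffAt (ho.mem_nhds (hmem s hs))).differentiableAt (by simp)
    have h2 : HasDerivAt (fun s : ℝ => a + s • (b - a)) (b - a) s := by
      simpa using ((hasDerivAt_id s).smul_const (b - a)).const_add a
    exact h1.hasFDerivAt.comp_hasDerivAt s h2
  have hm : MonotoneOn (fun s : ℝ => F (a + s • (b - a))) (Icc 0 1) := by
    apply monotoneOn_of_deriv_nonneg (convex_Icc 0 1)
    · exact fun s hs => (hder s hs).continuousAt.continuousWithinAt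
    · intro s hs
      exact (hder s (interior_subset hs)).differentiableAt.differentiableWithinAt
    · intro s hs
      have hs' := interior_subset hs
      rw [(hder s hs').deriv]
      have e : (b - a) = ∑ i, (b i - a i) • (Pi.single i (1:ℝ) : Fin n → ℝ) := by
        funext j
        simp [Finset.sum_apply, Pi.single_apply]
      rw [e, ← e, e, map_sum]
      apply Finset.sum_nonneg
      intro i _
      rw [map_smul, ← e]
      exact mul_nonneg (sub_nonneg.mpr (hab i)) (hd _ (hmem s hs') i).le
  have := hm (left_mem_Icc.mpr zero_le_one) (right_mem_Icc.mpr zero_le_one) zero_le_one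
  simpa using this

lemma aux_Fconst {n : ℕ} {Γ : Set (Fin n → ℝ)} (hΓ : GoodCone Γ) {F : (Fin n → ℝ) → ℝ} {k : ℝ}
    (hF : GoodF Γ F k) {r : ℝ} (hr : 0 < r) :
    (fun _ => 1 / r) ∈ Γ ∧ F (fun _ => 1 / r) = (r ^ k)⁻¹ := by
  obtain ⟨-, -, -, -, -, hp⟩ := hΓ
  obtain ⟨-, -, -, -, hh, -, h1⟩ := hF
  refine ⟨hp _ (fun i => by positivity), ?_⟩
  have := hh (1 / r) (fun _ => 1) (hp _ (fun i => by norm_num)) (by positivity)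
  rw [h1, mul_one] at this
  rw [← Real.inv_rpow hr.le, ← one_div, ← this]
  congr 1
  funext i
  simp

lemma aux_f_strict {n : ℕ} {f : E (n + 1) → ℝ} {k r₁ r₂ : ℝ} (hf : GoodPrescribed f k r₁ r₂)
    {x : E (n+1)} (hx : ‖x‖ = 1) : StrictMonoOn (fun s : ℝ => s ^ (-k) * f (s • x)) (Ioi 0) := by
  obtain ⟨-, -, hd, -⟩ := hf
  apply strictMonoOn_of_deriv_pos (convex_Ioi 0)
  · intro s hs
    exact (differentiableAt_of_deriv_ne_zero (hd x hx s hs).ne').continuousAt.continuousWithinAt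
  · intro s hs
    rw [interior_Ioi] at hs
    exact hd x hx s hs

lemma aux_f_gt {n : ℕ} {f : E (n + 1) → ℝ} {k r₁ r₂ : ℝ} (hf : GoodPrescribed f k r₁ r₂)
    {x : E (n+1)} (hx : ‖x‖ = 1) {r : ℝ} (hr : r₂ < r) : r ^ k < f (r • x) := by
  have h := aux_f_strict hf hx
  obtain ⟨-, -, -, h1, h12, -, h2⟩ := hf
  have hr2 : 0 < r₂ := h1.trans_le h12
  have hr0 : 0 < r := hr2.trans hr
  have h3 := h (mem_Ioi.mpr hr2) (mem_Ioi.mpr hr0) hr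
  have h4 := h2 (r₂ • x) (by rw [norm_smul, hx, mul_one, Real.norm_of_nonneg hr2.le])
  simp only [Real.rpow_neg hr2.le, Real.rpow_neg hr0.le] at h3
  have p1 := Real.rpow_pos_of_pos hr2 k
  have p2 := Real.rpow_pos_of_pos hr0 k
  have h5 : 1 ≤ (r₂ ^ k)⁻¹ * f (r₂ • x) := by
    rw [inv_mul_eq_div, le_div_iff₀ p1]; linarith
  have h6 : 1 < (r ^ k)⁻¹ * f (r • x) := by linarith
  rw [inv_mul_eq_div, lt_div_iff₀ p2] at h6
  linarith

lemma aux_f_lt {n : ℕ} {f : E (n + 1) → ℝ} {k r₁ r₂ : ℝ} (hf : GoodPrescribed f k r₁ r₂)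
    {x : E (n+1)} (hx : ‖x‖ = 1) {r : ℝ} (hr0 : 0 < r) (hr : r < r₁) : f (r • x) < r ^ k := by
  have h := aux_f_strict hf hx
  obtain ⟨-, -, -, h1, h12, h2, -⟩ := hf
  have h3 := h (mem_Ioi.mpr hr0) (mem_Ioi.mpr h1) hr
  have h4 := h2 (r₁ • x) (by rw [norm_smul, hx, mul_one, Real.norm_of_nonneg h1.le])
  simp only [Real.rpow_neg h1.le, Real.rpow_neg hr0.le] at h3
  have p1 := Real.rpow_pos_of_pos h1 k
  have p2 := Real.rpow_pos_of_pos hr0 k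
  have h5 : (r₁ ^ k)⁻¹ * f (r₁ • x) ≤ 1 := by
    rw [inv_mul_eq_div, div_le_iff₀ p1]; linarith
  have h6 : (r ^ k)⁻¹ * f (r • x) < 1 := by linarith
  rw [inv_mul_eq_div, div_lt_iff₀ p2] at h6
  linarith

lemma aux_calF {n : ℕ} {F : (Fin n → ℝ) → ℝ} {f : E (n + 1) → ℝ} {ρ : E (n+1) → ℝ}
    {x : E (n+1)} {κ : Fin n → ℝ} (hg : gradient ρ x = 0) (hpos : 0 < ρ x) :
    calF F f ρ x κ = 1 / F κ - f (ρ x • x) := by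
  have hs : Real.sqrt (ρ x ^ 2 + 0 ^ 2) = ρ x := by
    rw [show ρ x ^ 2 + (0:ℝ) ^ 2 = ρ x ^ 2 by ring]; exact Real.sqrt_sq hpos.le
  rw [calF, hg, norm_zero, hs]
  field_simp

/-- left derivative sign at a max in time -/
lemma aux_time {φ : ℝ → ℝ} {t : ℝ} (ht : 0 < t)
    (h : ∀ s ∈ Icc 0 t, φ s ≤ φ t) : 0 ≤ deriv φ t := by
  by_contra! hneg
  have hd := (differentiableAt_of_deriv_ne_zero hneg.ne).hasDerivAt
  have h1 := hd.tendsto_slope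
  have h2 : Filter.Tendsto (slope φ t) (nhdsWithin t (Iio t)) (nhds (deriv φ t)) :=
    h1.mono_left (nhdsWithin_mono _ (fun s hs => (ne_of_lt hs)))
  have h3 : 0 ≤ deriv φ t := by
    refine ge_of_tendsto h2 ?_
    have : Ioo 0 t ∈ nhdsWithin t (Iio t) := Ioo_mem_nhdsLT ht
    filter_upwards [this] with s hs
    rw [slope_def_field]
    have := h s ⟨hs.1.le, hs.2.le⟩
    exact div_nonneg_of_nonpos (by linarith) (by linarith [hs.2])
  linarith

lemma aux_extend {n : ℕ} {ρ : E n → ℝ} {x : E n} (hx : ‖x‖ = 1)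
    (hh : ∀ c : ℝ, 0 < c → ∀ y, ρ (c • y) = ρ y) (P : ℝ → Prop)
    (h : ∀ y, ‖y‖ = 1 → P (ρ y)) : ∀ᶠ y in nhds x, P (ρ y) := by
  have hx0 : x ≠ 0 := by intro h0; simp [h0] at hx
  filter_upwards [isOpen_ne.mem_nhds hx0] with y hy
  have hy' : 0 < ‖y‖ := norm_pos_iff.mpr hy
  rw [← hh (‖y‖⁻¹) (by positivity) y]
  apply h
  rw [norm_smul, norm_inv, norm_norm]
  field_simp

/-- Proposition 3.1, C⁰-estimates: any admissible solution of the flow on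
`[0,T]` satisfies `R₁ ≤ ρ ≤ R₂` with `R₁ = min(r₁, min ρ₀)`, `R₂ = max(r₂, max ρ₀)`. -/
theorem stmt11 (n : ℕ) (hn : 2 ≤ n) (Γ : Set (Fin n → ℝ)) (hΓ : GoodCone Γ)
    (F : (Fin n → ℝ) → ℝ) (k : ℝ) (hk : 0 < k) (hF : GoodF Γ F k)
    (hFb : FVanishesOnBoundary Γ F)
    (f : E (n + 1) → ℝ) (r₁ r₂ : ℝ) (hf : GoodPrescribed f k r₁ r₂)
    (T : ℝ) (hT : 0 < T) (ρ : ℝ → E (n + 1) → ℝ) (ρ₀ : E (n + 1) → ℝ)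
    (hsol : IsFlowSol Γ F f T ρ ρ₀) :
    ∀ t ∈ Icc (0 : ℝ) T, ∀ x : E (n + 1), ‖x‖ = 1 →
      min r₁ (sphMin ρ₀) ≤ ρ t x ∧ ρ t x ≤ max r₂ (sphMax ρ₀) := by
  obtain ⟨hsm, hhom, hpos, hadm, hflow, hinit⟩ := hsol
  have hFpos := hF.1
  have hsph : {x : E (n+1) | ‖x‖ = 1} = Metric.sphere 0 1 := by ext; simp
  have hcs : IsCompact {x : E (n+1) | ‖x‖ = 1} := by rw [hsph]; exact isCompact_sphere 0 1
  have hne : ∀ x : E (n+1), ‖x‖ = 1 → x ≠ 0 := by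
    intro x hx h0; simp [h0] at hx
  have hopen : IsOpen ((univ : Set ℝ) ×ˢ {y : E (n+1) | y ≠ 0}) :=
    isOpen_univ.prod isOpen_ne
  have hcd : ∀ t x, ‖x‖ = 1 → ContDiffAt ℝ 2 (ρ t) x := by
    intro t x hx
    have h1 : ContDiffAt ℝ (⊤ : ℕ∞) (fun p : ℝ × E (n + 1) => ρ p.1 p.2) (t, x) :=
      hsm.contDiffAt (hopen.mem_nhds ⟨mem_univ _, hne x hx⟩)
    have h2 : ContDiffAt ℝ 2 (fun p : ℝ × E (n + 1) => ρ p.1 p.2) (t, x) :=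
      h1.of_le (WithTop.coe_le_coe.mpr (le_top : (2 : ℕ∞) ≤ ⊤))
    exact h2.comp x (contDiffAt_const.prodMk contDiffAt_id)
  have hK : IsCompact (Icc (0:ℝ) T ×ˢ {x : E (n+1) | ‖x‖ = 1}) := isCompact_Icc.prod hcs
  have hcont : ContinuousOn (fun p : ℝ × E (n + 1) => ρ p.1 p.2)
      (Icc (0:ℝ) T ×ˢ {x : E (n+1) | ‖x‖ = 1}) :=
    hsm.continuousOn.mono (fun p hp => ⟨mem_univ _, hne _ hp.2⟩)
  have hc0 : ContinuousOn ρ₀ {x : E (n+1) | ‖x‖ = 1} := by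
    have : ContinuousOn (ρ 0) {x : E (n+1) | ‖x‖ = 1} :=
      fun x hx => (hcd 0 x hx).continuousAt.continuousWithinAt
    exact this.congr (fun x hx => (hinit x hx).symm)
  have himg := hcs.image_of_continuousOn hc0
  intro t ht x hx
  have hKne : (Icc (0:ℝ) T ×ˢ {x : E (n+1) | ‖x‖ = 1}).Nonempty := ⟨(t, x), ht, hx⟩
  constructor
  · obtain ⟨⟨t', x'⟩, ⟨ht', hx'⟩, hmin⟩ := hK.exists_isMinOn hKne hcont
    simp only [mem_ofPred_eq] at hx'
    have hmin' : ∀ s ∈ Icc (0:ℝ) T, ∀ y, ‖y‖ = 1 → ρ t' x' ≤ ρ s y :=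
      fun s hs y hy => hmin (a := (s, y)) ⟨hs, hy⟩
    refine le_trans ?_ (hmin' t ht x hx)
    by_contra! hlt
    obtain ⟨hl1, hl2⟩ := lt_min_iff.mp hlt
    have ht0 : 0 < t' := by
      rcases ht'.1.lt_or_eq with h | h
      · exact h
      · exfalso
        have h0 := hinit x' hx'
        rw [h] at h0
        have : sphMin ρ₀ ≤ ρ₀ x' := csInf_le himg.bddBelow ⟨x', hx', rfl⟩
        rw [h0] at hl2
        linarith
    have hloc : IsLocalMin (ρ t') x' :=
      aux_extend hx' (hhom t' ht') (fun v => ρ t' x' ≤ v) (fun y hy => hmin' t' ht' y hy)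
    have hg : gradient (ρ t') x' = 0 := aux_grad hloc.fderiv_eq_zero
    have hp := hpos t' ht' x' hx'
    obtain ⟨κ, hκΓ, hκ⟩ := hadm t' ht' x' hx'
    have hd := hflow t' ht' x' hx' κ hκ
    rw [aux_calF hg hp] at hd
    have hle : ∀ i, κ i ≤ 1 / ρ t' x' := by
      intro i
      obtain ⟨w, hw, he⟩ := aux_curv hg hp hκ i
      have h1 := aux_hess_min _ x' w (hcd t' x' hx') hloc
      have h2 : 0 ≤ hess (ρ t') x' w w / ρ t' x' := div_nonneg h1 hp.le
      have h3 : 0 < ρ t' x' * ‖w‖ ^ 2 := mul_pos hp hw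
      by_contra! hc
      have := mul_pos (sub_pos.mpr hc) h3
      linarith
    obtain ⟨hcΓ, hcF⟩ := aux_Fconst hΓ hF hp
    have hFle := aux_mono hΓ hF hκΓ hcΓ hle
    rw [hcF] at hFle
    have h4 : ρ t' x' ^ k ≤ 1 / F κ := by
      rw [one_div]
      exact (le_inv_comm₀ (Real.rpow_pos_of_pos hp k) (hFpos κ hκΓ)).mpr hFle
    have h5 := aux_f_lt hf hx' hp hl1
    have h6 := aux_time (φ := fun s => - ρ s x') ht0 (fun s hs =>
      neg_le_neg (hmin' s ⟨hs.1, hs.2.trans ht'.2⟩ x' hx'))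
    rw [deriv.fun_neg, hd] at h6
    linarith
  · obtain ⟨⟨t', x'⟩, ⟨ht', hx'⟩, hmax⟩ := hK.exists_isMaxOn hKne hcont
    simp only [mem_ofPred_eq] at hx'
    have hmax' : ∀ s ∈ Icc (0:ℝ) T, ∀ y, ‖y‖ = 1 → ρ s y ≤ ρ t' x' :=
      fun s hs y hy => hmax (a := (s, y)) ⟨hs, hy⟩
    refine le_trans (hmax' t ht x hx) ?_
    by_contra! hlt
    obtain ⟨hl1, hl2⟩ := max_lt_iff.mp hlt
    have ht0 : 0 < t' := by
      rcases ht'.1.lt_or_eq with h | h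
      · exact h
      · exfalso
        have h0 := hinit x' hx'
        rw [h] at h0
        have : ρ₀ x' ≤ sphMax ρ₀ := le_csSup himg.bddAbove ⟨x', hx', rfl⟩
        rw [h0] at hl2
        linarith
    have hloc : IsLocalMax (ρ t') x' :=
      aux_extend hx' (hhom t' ht') (fun v => v ≤ ρ t' x') (fun y hy => hmax' t' ht' y hy)
    have hg : gradient (ρ t') x' = 0 := aux_grad hloc.fderiv_eq_zero
    have hp := hpos t' ht' x' hx'
    obtain ⟨κ, hκΓ, hκ⟩ := hadm t' ht' x' hx'
    have hd := hflow t' ht' x' hx' κ hκ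
    rw [aux_calF hg hp] at hd
    have hle : ∀ i, 1 / ρ t' x' ≤ κ i := by
      intro i
      obtain ⟨w, hw, he⟩ := aux_curv hg hp hκ i
      have h1 := aux_hess_max _ x' w (hcd t' x' hx') hloc
      have h2 : hess (ρ t') x' w w / ρ t' x' ≤ 0 := div_nonpos_of_nonpos_of_nonneg h1 hp.le
      have h3 : 0 < ρ t' x' * ‖w‖ ^ 2 := mul_pos hp hw
      by_contra! hc
      have := mul_neg_of_neg_of_pos (sub_neg.mpr hc) h3
      linarith
    obtain ⟨hcΓ, hcF⟩ := aux_Fconst hΓ hF hp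
    have hFle := aux_mono hΓ hF hcΓ hκΓ hle
    rw [hcF] at hFle
    have h4 : 1 / F κ ≤ ρ t' x' ^ k := by
      rw [one_div]
      exact (inv_le_comm₀ (Real.rpow_pos_of_pos hp k) (hFpos κ hκΓ)).mp hFle
    have h5 := aux_f_gt hf hx' hl1
    have h6 := aux_time (φ := fun s => ρ s x') ht0 (fun s hs =>
      hmax' s ⟨hs.1, hs.2.trans ht'.2⟩ x' hx')
    rw [hd] at h6
    linarith
end
end

section
/- Assume Γ, F (of homogeneity degree k > 0), and f (with constants 0 < r₁ ≤ r₂) satisfy the structure conditions of the context. Let ρ₀ : Sⁿ → (0,∞) be smooth and admissible, and suppose 𝓕[ρ₀] ≥ 0 everywhere on Sⁿ if k ≤ 1, and 𝓕[ρ₀] ≤ 0 everywhere on Sⁿ if k > 1. Set R₁ = min(r₁, min_{Sⁿ}ρ₀) and R₂ = max(r₂, max_{Sⁿ}ρ₀). Then there exists λ > 0, depending only on f, r₁, r₂ and ρ₀ (in particular independent of T), such that for every T > 0 and every admissible solution ρ : [0,T]×Sⁿ → (0,∞) of the flow ∂ₜρ = 𝓕[ρ(t,·)] with initial datum ρ₀: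 (i) ∂ₜρ(t,x) ≥ 0 for all (t,x) if k ≤ 1 and ∂ₜρ(t,x) ≤ 0 for all (t,x) if k > 1; (ii) max_{x∈Sⁿ}|∂ₜρ(t,x)| ≤ (R₂/R₁)·max_{x∈Sⁿ}|𝓕[ρ₀](x)|·e^{−λt} for every t ∈ [0,T]. -/
open scoped RealInnerProductSpace
open Set

noncomputable section

lemma two_le_top : (2 : WithTop ℕ∞) ≤ ((⊤ : ℕ∞) : WithTop ℕ∞) := by
  have : ((2 : ℕ∞) : WithTop ℕ∞) ≤ ((⊤ : ℕ∞) : WithTop ℕ∞) := WithTop.coe_le_coe.mpr le_top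
  exact this

lemma fderiv_diff {m : ℕ} {ρ : E m → ℝ} {x : E m} (h : ContDiffAt ℝ (⊤ : ℕ∞) ρ x) :
    DifferentiableAt ℝ (fderiv ℝ ρ) x :=
  (h.fderiv_right (m := 1) (by rw [one_add_one_eq_two]; exact two_le_top)).differentiableAt
    (by norm_num)

open Filter Topology in
lemma aux_second {g : ℝ → ℝ} (hg : ContinuousAt g 0) (hm : IsLocalMax g 0) :
    deriv (deriv g) 0 ≤ 0 := by
  by_contra hpos
  push Not at hpos
  have h1 : deriv g 0 = 0 := hm.deriv_eq_zero
  have h2 : IsLocalMin g 0 := isLocalMin_of_deriv_deriv_pos hpos h1 hg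
  have h3 : g =ᶠ[𝓝 0] fun _ => g 0 := by
    filter_upwards [hm, h2] with y h4 h5
    exact le_antisymm h4 h5
  have h4 : deriv g =ᶠ[𝓝 0] deriv (fun _ => g 0) := h3.deriv
  have h5 := h4.deriv_eq
  simp at h5
  linarith

lemma grad_diff {m : ℕ} {ρ : E m → ℝ} {x : E m} (h : ContDiffAt ℝ (⊤ : ℕ∞) ρ x) :
    DifferentiableAt ℝ (gradient ρ) x := by
  rw [differentiableAt_euclidean]
  intro i
  have h1 : DifferentiableAt ℝ (fderiv ℝ ρ) x :=
    fderiv_diff h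
  have h2 : (fun y => gradient ρ y i) = fun y => fderiv ℝ ρ y (EuclideanSpace.single i 1) := by
    funext y
    rw [← inner_gradient_left, EuclideanSpace.inner_single_right]
    simp
  rw [h2]
  exact h1.clm_apply (differentiableAt_const _)

lemma hess_eq {m : ℕ} {ρ : E m → ℝ} {x : E m} (h : ContDiffAt ℝ (⊤ : ℕ∞) ρ x) (u w : E m) :
    hess ρ x u w = fderiv ℝ (fderiv ℝ ρ) x u w := by
  have h1 : DifferentiableAt ℝ (fderiv ℝ ρ) x :=
    fderiv_diff h
  have h2 : fderiv ℝ (fun y => ⟪gradient ρ y, w⟫) x u = ⟪fderiv ℝ (gradient ρ) x u, w⟫ := by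
    rw [fderiv_inner_apply ℝ (grad_diff h) (differentiableAt_const w)]
    simp
  have h3 : (fun y => ⟪gradient ρ y, w⟫) = fun y => fderiv ℝ ρ y w := by
    funext y
    rw [← inner_gradient_left]
  rw [hess, ← h2, h3, fderiv_clm_apply h1 (differentiableAt_const w)]
  simp

lemma hess_symm {m : ℕ} {ρ : E m → ℝ} {x : E m} (h : ContDiffAt ℝ (⊤ : ℕ∞) ρ x) (u w : E m) :
    hess ρ x u w = hess ρ x w u := by
  rw [hess_eq h, hess_eq h]
  exact (h.isSymmSndFDerivAt (by simpa using two_le_top)) u w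

open Filter Topology in
lemma touch_hess {m : ℕ} {d : E m → ℝ} {x : E m} (h : ContDiffAt ℝ (⊤ : ℕ∞) d x)
    (hm : IsLocalMax d x) (u : E m) : fderiv ℝ (fderiv ℝ d) x u u ≤ 0 := by
  have h1 : DifferentiableAt ℝ (fderiv ℝ d) x :=
    fderiv_diff h
  set ℓ : ℝ → E m := fun s => x + s • u with hℓ
  have hℓ0 : ℓ 0 = x := by simp [hℓ]
  have hℓd : ∀ s, HasDerivAt ℓ u s := by
    intro s
    have := ((hasDerivAt_id s).smul_const u).const_add x
    simpa [hℓ] using this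
  have hℓc : ContinuousAt ℓ 0 := (hℓd 0).continuousAt
  have hℓt : Tendsto ℓ (𝓝 0) (𝓝 x) := by
    have := hℓc.tendsto
    rwa [hℓ0] at this
  have hc : ContinuousAt (d ∘ ℓ) 0 :=
    ContinuousAt.comp (by rw [hℓ0]; exact h.continuousAt) hℓc
  have hmm : IsLocalMax (d ∘ ℓ) 0 := by
    have : ∀ᶠ s in 𝓝 (0:ℝ), d (ℓ s) ≤ d x := hℓt.eventually hm
    filter_upwards [this] with s hs
    simpa [hℓ0] using hs
  have hd1 : deriv (d ∘ ℓ) =ᶠ[𝓝 0] fun s => fderiv ℝ d (ℓ s) u := by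
    have hev : ∀ᶠ y in 𝓝 x, DifferentiableAt ℝ d y := by
      have := (h.of_le (m := 1) (by exact_mod_cast le_top)).eventually (by simp)
      filter_upwards [this] with y hy
      exact hy.differentiableAt (by norm_num)
    filter_upwards [hℓt.eventually hev] with s hs
    exact (hs.hasFDerivAt.comp_hasDerivAt s (hℓd s)).deriv
  have h2 := aux_second hc hmm
  rw [hd1.deriv_eq] at h2
  have h3 : HasDerivAt (fun s => fderiv ℝ d (ℓ s) u) (fderiv ℝ (fderiv ℝ d) x u u) 0 := by
    have h4 : HasFDerivAt (fderiv ℝ d) (fderiv ℝ (fderiv ℝ d) x) (ℓ 0) := by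
      rw [hℓ0]; exact h1.hasFDerivAt
    have h5 := h4.comp_hasDerivAt (0:ℝ) (hℓd 0)
    have h6 := h5.clm_apply (hasDerivAt_const (0:ℝ) u)
    simpa using h6
  rwa [h3.deriv] at h2

lemma contDiffAt_of {m : ℕ} {ρ : E m → ℝ} (h : ContDiffOn ℝ (⊤ : ℕ∞) ρ {y | y ≠ 0}) {x : E m}
    (hx : x ≠ 0) : ContDiffAt ℝ (⊤ : ℕ∞) ρ x :=
  h.contDiffAt (isOpen_ne.mem_nhds hx)

open Filter Topology in
lemma touch {m : ℕ} {ρ₁ ρ₂ : E m → ℝ} (h₁ : ContDiffOn ℝ (⊤ : ℕ∞) ρ₁ {y | y ≠ 0})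
    (h₂ : ContDiffOn ℝ (⊤ : ℕ∞) ρ₂ {y | y ≠ 0})
    (hh₁ : ∀ c : ℝ, 0 < c → ∀ y, ρ₁ (c • y) = ρ₁ y)
    (hh₂ : ∀ c : ℝ, 0 < c → ∀ y, ρ₂ (c • y) = ρ₂ y)
    {x : E m} (hx : ‖x‖ = 1) {c : ℝ} (hle : ∀ y, ‖y‖ = 1 → ρ₁ y ≤ c * ρ₂ y)
    (heq : ρ₁ x = c * ρ₂ x) :
    gradient ρ₁ x = c • gradient ρ₂ x ∧ ∀ u, hess ρ₁ x u u ≤ c * hess ρ₂ x u u := by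
  have hx0 : x ≠ 0 := by
    rintro rfl
    simp at hx
  have c₁ := contDiffAt_of h₁ hx0
  have c₂ := contDiffAt_of h₂ hx0
  set d : E m → ℝ := fun y => ρ₁ y - c * ρ₂ y with hd
  have hdc : ContDiffAt ℝ (⊤ : ℕ∞) d x := c₁.sub (contDiffAt_const.mul c₂)
  have hm : IsLocalMax d x := by
    filter_upwards [isOpen_ne.mem_nhds hx0] with y hy
    have hy' : 0 < ‖y‖ := norm_pos_iff.mpr hy
    have e1 := hh₁ ‖y‖⁻¹ (inv_pos.mpr hy') y
    have e2 := hh₂ ‖y‖⁻¹ (inv_pos.mpr hy') y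
    have e3 := hle (‖y‖⁻¹ • y) (by rw [norm_smul]; simp [hy'.ne'])
    simp only [hd]
    rw [e1, e2] at e3
    linarith
  have dif : ∀ {ρ : E m → ℝ} {y : E m}, ContDiffAt ℝ (⊤ : ℕ∞) ρ y → DifferentiableAt ℝ ρ y :=
    fun h => h.differentiableAt (by simp)
  have hfd : ∀ y, y ≠ 0 → fderiv ℝ d y = fderiv ℝ ρ₁ y - c • fderiv ℝ ρ₂ y := by
    intro y hy
    have d1 := dif (contDiffAt_of h₁ hy)
    have d2 := dif (contDiffAt_of h₂ hy)
    rw [hd, fderiv_fun_sub d1 (d2.const_mul c), fderiv_const_mul d2]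
  constructor
  · have h0 := hm.fderiv_eq_zero
    rw [hfd x hx0] at h0
    apply ext_inner_right ℝ
    intro v
    rw [inner_smul_left, inner_gradient_left, inner_gradient_left]
    have := congrArg (fun L => L v) h0
    simp at this
    simp; linarith
  · intro u
    have h0 := touch_hess hdc hm u
    have hev : fderiv ℝ d =ᶠ[𝓝 x] fun y => fderiv ℝ ρ₁ y - c • fderiv ℝ ρ₂ y := by
      filter_upwards [isOpen_ne.mem_nhds hx0] with y hy
      exact hfd y hy
    have d1 : DifferentiableAt ℝ (fderiv ℝ ρ₁) x :=
      fderiv_diff c₁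
    have d2 : DifferentiableAt ℝ (fderiv ℝ ρ₂) x :=
      fderiv_diff c₂
    rw [hev.fderiv_eq, fderiv_fun_sub d1 (d2.fun_const_smul c), fderiv_fun_const_smul d2] at h0
    rw [hess_eq c₁, hess_eq c₂]
    simp at h0
    linarith
lemma span_quad {V ι : Type*} [AddCommGroup V] [Module ℝ V] [Fintype ι]
    (h g : V →ₗ[ℝ] V →ₗ[ℝ] ℝ) (hs : ∀ u v, h u v = h v u) (gs : ∀ u v, g u v = g v u)
    (gp : ∀ u, 0 ≤ g u u) (w : ι → V) (κ : ι → ℝ)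
    (hw : ∀ i j, h (w j) (w i) = κ i * g (w j) (w i)) (c : ℝ) (hc : ∀ i, c ≤ κ i)
    (u : V) (hu : u ∈ Submodule.span ℝ (Set.range w)) : c * g u u ≤ h u u := by
  obtain ⟨a, rfl⟩ := (Submodule.mem_span_range_iff_exists_fun ℝ).mp hu
  have hg := gp (∑ i, (Real.sqrt (κ i - c) * a i) • w i)
  have key : ∀ i j, (κ i - κ j) * g (w j) (w i) = 0 := by
    intro i j
    have h1 := hw i j
    have h2 := hw j i
    rw [hs, gs] at h2
    linarith
  simp only [map_sum, LinearMap.sum_apply, map_smul, LinearMap.smul_apply, smul_eq_mul] at hg ⊢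
  rw [Finset.mul_sum, ← sub_nonneg, ← Finset.sum_sub_distrib]
  refine hg.trans (le_of_eq ?_)
  refine Finset.sum_congr rfl fun i _ => ?_
  rw [Finset.mul_sum, Finset.mul_sum, Finset.mul_sum, Finset.mul_sum, ← Finset.sum_sub_distrib]
  refine Finset.sum_congr rfl fun j _ => ?_
  rw [hw]
  rcases mul_eq_zero.mp (key i j) with h0 | h0
  · have e : κ j = κ i := by linarith
    have e2 := Real.mul_self_sqrt (sub_nonneg.mpr (hc i))
    rw [e]
    linear_combination (a i * a j * g (w j) (w i)) * e2
  · rw [h0]; ring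

lemma span_quad' {V ι : Type*} [AddCommGroup V] [Module ℝ V] [Fintype ι]
    (h g : V →ₗ[ℝ] V →ₗ[ℝ] ℝ) (hs : ∀ u v, h u v = h v u) (gs : ∀ u v, g u v = g v u)
    (gp : ∀ u, 0 ≤ g u u) (w : ι → V) (κ : ι → ℝ)
    (hw : ∀ i j, h (w j) (w i) = κ i * g (w j) (w i)) (c : ℝ) (hc : ∀ i, κ i ≤ c)
    (u : V) (hu : u ∈ Submodule.span ℝ (Set.range w)) : h u u ≤ c * g u u := by
  have := span_quad (-h) g (fun u v => by simp [hs u v]) gs gp w (fun i => - κ i)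
    (fun i j => by simp [hw]) (-c) (fun i => by simpa using hc i) u hu
  simp at this
  linarith

def gL {m : ℕ} (ρ : E m → ℝ) (x : E m) : E m →ₗ[ℝ] E m →ₗ[ℝ] ℝ :=
  LinearMap.mk₂ ℝ (gForm ρ x)
    (fun u v w => by simp [gForm, inner_add_left, inner_add_right]; ring)
    (fun c u w => by simp [gForm, inner_smul_left, inner_smul_right]; ring)
    (fun u v w => by simp [gForm, inner_add_left, inner_add_right]; ring)
    (fun c u w => by simp [gForm, inner_smul_left, inner_smul_right]; ring)

def hL {m : ℕ} (ρ : E m → ℝ) (x : E m) : E m →ₗ[ℝ] E m →ₗ[ℝ] ℝ :=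
  LinearMap.mk₂ ℝ (hForm ρ x)
    (fun u v w => by simp [hForm, hess, inner_add_left, inner_add_right]; ring)
    (fun c u w => by simp [hForm, hess, inner_smul_left, inner_smul_right]; ring)
    (fun u v w => by simp [hForm, hess, inner_add_left, inner_add_right]; ring)
    (fun c u w => by simp [hForm, hess, inner_smul_left, inner_smul_right]; ring)

lemma gL_apply {m : ℕ} (ρ : E m → ℝ) (x u v : E m) : gL ρ x u v = gForm ρ x u v := rfl
lemma hL_apply {m : ℕ} (ρ : E m → ℝ) (x u v : E m) : hL ρ x u v = hForm ρ x u v := rfl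

lemma gForm_symm {m : ℕ} (ρ : E m → ℝ) (x u v : E m) : gForm ρ x u v = gForm ρ x v u := by
  simp only [gForm, real_inner_comm u v]; ring

lemma hForm_symm {m : ℕ} {ρ : E m → ℝ} {x : E m} (h : ContDiffAt ℝ (⊤ : ℕ∞) ρ x) (u v : E m) :
    hForm ρ x u v = hForm ρ x v u := by
  simp only [hForm, real_inner_comm u v, hess_symm h u v]; ring

lemma gForm_nonneg {m : ℕ} (ρ : E m → ℝ) (x u : E m) : 0 ≤ gForm ρ x u u := by
  simp only [gForm]
  have := real_inner_self_nonneg (x := u)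
  have := mul_self_nonneg ⟪gradient ρ x, u⟫
  positivity

lemma gForm_pos {m : ℕ} {ρ : E m → ℝ} {x u : E m} (hx : ρ x ≠ 0) (hu : u ≠ 0) :
    0 < gForm ρ x u u := by
  simp only [gForm]
  have := real_inner_self_pos.mpr hu
  have := mul_self_nonneg ⟪gradient ρ x, u⟫
  positivity

lemma exists_common {n : ℕ} {x : E (n + 1)} (hx : x ≠ 0) {w₁ w₂ : Fin n → E (n + 1)}
    (l₁ : LinearIndependent ℝ w₁) (l₂ : LinearIndependent ℝ w₂)
    (p₁ : ∀ i, ⟪x, w₁ i⟫ = 0) (p₂ : ∀ i, ⟪x, w₂ i⟫ = 0) (i : Fin n) :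
    ∃ u : E (n + 1), u ≠ 0 ∧
      u ∈ Submodule.span ℝ (Set.range fun j : {j : Fin n // j ≤ i} => w₁ j) ∧
      u ∈ Submodule.span ℝ (Set.range fun j : {j : Fin n // i ≤ j} => w₂ j) := by
  set S := Submodule.span ℝ (Set.range fun j : {j : Fin n // j ≤ i} => w₁ j) with hS
  set S' := Submodule.span ℝ (Set.range fun j : {j : Fin n // i ≤ j} => w₂ j) with hS'
  have f1 : Module.finrank ℝ S = i + 1 := by
    have e := finrank_span_eq_card (l₁.comp (Subtype.val : {j : Fin n // j ≤ i} → Fin n)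
      Subtype.val_injective)
    rw [Fintype.card_of_subtype (Finset.Iic i) (by simp), Fin.card_Iic] at e
    exact e
  have f2 : Module.finrank ℝ S' = n - i := by
    have e := finrank_span_eq_card (l₂.comp (Subtype.val : {j : Fin n // i ≤ j} → Fin n)
      Subtype.val_injective)
    rw [Fintype.card_of_subtype (Finset.Ici i) (by simp), Fin.card_Ici] at e
    exact e
  have hle : S ⊔ S' ≤ (Submodule.span ℝ {x})ᗮ := by
    rw [sup_le_iff, hS, hS', Submodule.span_le, Submodule.span_le]
    constructor
    · rintro _ ⟨j, rfl⟩
      exact Submodule.mem_orthogonal_singleton_iff_inner_right.mpr (p₁ j)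
    · rintro _ ⟨j, rfl⟩
      exact Submodule.mem_orthogonal_singleton_iff_inner_right.mpr (p₂ j)
  have : Fact (Module.finrank ℝ (E (n + 1)) = n + 1) := ⟨by simp⟩
  have f3 : Module.finrank ℝ (Submodule.span ℝ {x})ᗮ = n := Submodule.finrank_orthogonal_span_singleton hx
  have f4 := Submodule.finrank_mono hle
  have f5 := Submodule.finrank_sup_add_finrank_inf_eq S S'
  have hi := i.2
  have f6 : 0 < Module.finrank ℝ ↥(S ⊓ S') := by omega
  have f7 : S ⊓ S' ≠ ⊥ := by
    intro hb
    rw [hb] at f6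
    simp at f6
  obtain ⟨u, hu, hu0⟩ := Submodule.exists_mem_ne_zero_of_ne_bot f7
  exact ⟨u, hu0, hu.1, hu.2⟩

lemma F_mono {n : ℕ} {Γ : Set (Fin n → ℝ)} (hΓ : GoodCone Γ) {F : (Fin n → ℝ) → ℝ} {k : ℝ}
    (hF : GoodF Γ F k) {l m : Fin n → ℝ} (hl : l ∈ Γ) (hm : m ∈ Γ) (hlm : ∀ i, l i ≤ m i) :
    F l ≤ F m := by
  have hin : ∀ s ∈ Icc (0:ℝ) 1, l + s • (m - l) ∈ Γ := by
    intro s hs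
    have hcv : Convex ℝ Γ := hΓ.2.1
    have := hcv hl hm (show (0:ℝ) ≤ 1 - s by linarith [hs.2]) hs.1 (by ring)
    convert this using 1
    ext i; simp; ring
  have hd : ∀ s ∈ Icc (0:ℝ) 1, HasDerivAt (fun s : ℝ => F (l + s • (m - l)))
      (fderiv ℝ F (l + s • (m - l)) (m - l)) s := by
    intro s hs
    have h1 : DifferentiableAt ℝ F (l + s • (m - l)) :=
      (hF.2.1.contDiffAt (hΓ.1.mem_nhds (hin s hs))).differentiableAt (by simp)
    have h2 : HasDerivAt (fun s : ℝ => l + s • (m - l)) (m - l) s := by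
      simpa using ((hasDerivAt_id s).smul_const (m - l)).const_add l
    exact h1.hasFDerivAt.comp_hasDerivAt s h2
  have hmono : MonotoneOn (fun s : ℝ => F (l + s • (m - l))) (Icc 0 1) := by
    apply monotoneOn_of_deriv_nonneg (convex_Icc 0 1)
    · intro s hs
      exact (hd s hs).continuousAt.continuousWithinAt
    · intro s hs
      rw [interior_Icc] at hs
      exact (hd s (Ioo_subset_Icc_self hs)).differentiableAt.differentiableWithinAt
    · intro s hs
      rw [interior_Icc] at hs
      have hs' := Ioo_subset_Icc_self hs
      rw [(hd s hs').deriv]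
      have e : m - l = ∑ i, (m i - l i) • (Pi.single i 1 : Fin n → ℝ) := by
        rw [pi_eq_sum_univ' (m - l)]
        refine Finset.sum_congr rfl fun i _ => ?_
        ext j
        simp [Pi.single_apply, eq_comm]
      have e2 : ∀ L : (Fin n → ℝ) →L[ℝ] ℝ, L (m - l) = ∑ i, (m i - l i) * L (Pi.single i 1) := by
        intro L
        conv_lhs => rw [e]
        simp
      rw [e2]
      refine Finset.sum_nonneg fun i _ => mul_nonneg (by linarith [hlm i]) ?_
      exact (hF.2.2.2.1 _ (hin s hs') i).le
  have := hmono (left_mem_Icc.mpr zero_le_one) (right_mem_Icc.mpr zero_le_one) zero_le_one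
  simpa using this

lemma HasPrincCurv.perm {n : ℕ} {ρ : E (n + 1) → ℝ} {x : E (n + 1)} {κ : Fin n → ℝ}
    (h : HasPrincCurv ρ x κ) (σ : Equiv.Perm (Fin n)) : HasPrincCurv ρ x (κ ∘ σ) := by
  obtain ⟨w, hl, hp, he⟩ := h
  exact ⟨w ∘ σ, hl.comp _ σ.injective, fun i => hp _, fun i u hu => he _ u hu⟩

/-- Comparison of curvatures at a touching point. -/
lemma touch_F {n : ℕ} {Γ : Set (Fin n → ℝ)} (hΓ : GoodCone Γ) {F : (Fin n → ℝ) → ℝ} {k : ℝ}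
    (hF : GoodF Γ F k) {ρ₁ ρ₂ : E (n + 1) → ℝ} {x : E (n + 1)} (hx : x ≠ 0)
    (c₁ : ContDiffAt ℝ (⊤ : ℕ∞) ρ₁ x) (c₂ : ContDiffAt ℝ (⊤ : ℕ∞) ρ₂ x) {c : ℝ} (hc : 0 < c)
    (hpos : 0 < ρ₂ x)
    (heq : ρ₁ x = c * ρ₂ x) (hg : gradient ρ₁ x = c • gradient ρ₂ x)
    (hh : ∀ u, hess ρ₁ x u u ≤ c * hess ρ₂ x u u) {κ₁ κ₂ : Fin n → ℝ} (hκ₁ : κ₁ ∈ Γ)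
    (hκ₂ : κ₂ ∈ Γ) (hp₁ : HasPrincCurv ρ₁ x κ₁) (hp₂ : HasPrincCurv ρ₂ x κ₂) :
    F κ₂ ≤ c ^ k * F κ₁ := by
  wlog hm : Monotone κ₁ ∧ Monotone κ₂ generalizing κ₁ κ₂
  · have := this (hΓ.2.2.2.2.1 (Tuple.sort κ₁) _ hκ₁) (hΓ.2.2.2.2.1 (Tuple.sort κ₂) _ hκ₂)
      (hp₁.perm _) (hp₂.perm _) ⟨Tuple.monotone_sort _, Tuple.monotone_sort _⟩
    rwa [hF.2.2.1 _ _ hκ₁, hF.2.2.1 _ _ hκ₂] at this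
  obtain ⟨hm₁, hm₂⟩ := hm
  rw [← hF.2.2.2.2.1 c κ₁ hκ₁ hc]
  apply F_mono hΓ hF hκ₂ (hΓ.2.2.2.1 c _ hκ₁ hc)
  intro i
  obtain ⟨w₁, l₁, p₁, e₁⟩ := hp₁
  obtain ⟨w₂, l₂, p₂, e₂⟩ := hp₂
  obtain ⟨u, hu0, hu1, hu2⟩ := exists_common hx l₁ l₂ p₁ p₂ i
  have q1 := span_quad' (hL ρ₁ x) (gL ρ₁ x) (hForm_symm c₁) (gForm_symm ρ₁ x) (gForm_nonneg ρ₁ x)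
    (fun j : {j : Fin n // j ≤ i} => w₁ j) (fun j => κ₁ j) (fun a b => e₁ a _ (p₁ b)) (κ₁ i)
    (fun j => hm₁ j.2) u hu1
  have q2 := span_quad (hL ρ₂ x) (gL ρ₂ x) (hForm_symm c₂) (gForm_symm ρ₂ x) (gForm_nonneg ρ₂ x)
    (fun j : {j : Fin n // i ≤ j} => w₂ j) (fun j => κ₂ j) (fun a b => e₂ a _ (p₂ b)) (κ₂ i)
    (fun j => hm₂ j.2) u hu2
  rw [gL_apply, hL_apply] at q1 q2
  have gpos : 0 < gForm ρ₂ x u u := gForm_pos hpos.ne' hu0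
  have ge : gForm ρ₁ x u u = c ^ 2 * gForm ρ₂ x u u := by
    simp only [gForm, heq, hg, inner_smul_left]; simp; ring
  have hW : Real.sqrt ((ρ₁ x) ^ 2 + ‖gradient ρ₁ x‖ ^ 2)
      = c * Real.sqrt ((ρ₂ x) ^ 2 + ‖gradient ρ₂ x‖ ^ 2) := by
    rw [heq, hg, norm_smul, Real.norm_of_nonneg hc.le]
    rw [show (c * ρ₂ x) ^ 2 + (c * ‖gradient ρ₂ x‖) ^ 2
      = c ^ 2 * ((ρ₂ x) ^ 2 + ‖gradient ρ₂ x‖ ^ 2) by ring]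
    rw [Real.sqrt_mul (by positivity), Real.sqrt_sq hc.le]
  have hWp : 0 < Real.sqrt ((ρ₂ x) ^ 2 + ‖gradient ρ₂ x‖ ^ 2) := by positivity
  have he : c * hForm ρ₂ x u u ≤ hForm ρ₁ x u u := by
    simp only [hForm, hW]
    rw [le_div_iff₀ (by positivity), heq, hg, inner_smul_left]
    field_simp
    have := mul_le_mul_of_nonneg_left (hh u) hpos.le
    simp only [conj_trivial]
    nlinarith [this, mul_le_mul_of_nonneg_left this hc.le]
  rw [ge] at q1
  simp only [Pi.smul_apply, smul_eq_mul]
  have : κ₂ i * (c * gForm ρ₂ x u u) ≤ c * κ₁ i * (c * gForm ρ₂ x u u) := by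
    nlinarith [mul_le_mul_of_nonneg_left q2 hc.le]
  exact le_of_mul_le_mul_right this (by positivity)
lemma grad_scale {m : ℕ} (ρ : E m → ℝ) (c : ℝ) :
    gradient (fun y => c * ρ y) = fun y => c • gradient ρ y := by
  funext y
  apply ext_inner_right ℝ
  intro v
  rw [inner_smul_left, inner_gradient_left, inner_gradient_left]
  have : fderiv ℝ (fun y => c * ρ y) y = c • fderiv ℝ ρ y :=
    congrFun (fderiv_const_smul_field (𝕜 := ℝ) (f := ρ) c) y
  rw [this]; simp

lemma hess_scale {m : ℕ} (ρ : E m → ℝ) (c : ℝ) (x u w : E m) :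
    hess (fun y => c * ρ y) x u w = c * hess ρ x u w := by
  rw [hess, hess, grad_scale]
  have : fderiv ℝ (fun y => c • gradient ρ y) x = c • fderiv ℝ (gradient ρ) x :=
    congrFun (fderiv_const_smul_field (𝕜 := ℝ) (f := gradient ρ) c) x
  rw [this]; simp [inner_smul_left]

lemma W_scale {a c : ℝ} (hc : 0 < c) {m : ℕ} (v : E m) :
    Real.sqrt ((c * a) ^ 2 + ‖c • v‖ ^ 2) = c * Real.sqrt (a ^ 2 + ‖v‖ ^ 2) := by
  rw [norm_smul, Real.norm_of_nonneg hc.le]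
  rw [show (c * a) ^ 2 + (c * ‖v‖) ^ 2 = c ^ 2 * (a ^ 2 + ‖v‖ ^ 2) by ring]
  rw [Real.sqrt_mul (by positivity), Real.sqrt_sq hc.le]

lemma HasPrincCurv.scale {n : ℕ} {ρ : E (n + 1) → ℝ} {x : E (n + 1)} {κ : Fin n → ℝ}
    (hρ : 0 < ρ x)
    (h : HasPrincCurv ρ x κ) {c : ℝ} (hc : 0 < c) :
    HasPrincCurv (fun y => c * ρ y) x (c⁻¹ • κ) := by
  obtain ⟨w, hl, hp, he⟩ := h
  refine ⟨w, hl, hp, fun i u hu => ?_⟩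
  have e := he i u hu
  have hW : 0 < Real.sqrt ((ρ x) ^ 2 + ‖gradient ρ x‖ ^ 2) := by positivity
  simp only [hForm, gForm, hess_scale, grad_scale, W_scale hc, inner_smul_left, conj_trivial,
    Pi.smul_apply, smul_eq_mul] at e ⊢
  rw [div_eq_iff hW.ne'] at e
  rw [div_eq_iff (by positivity)]
  field_simp
  linear_combination e

section
variable {n : ℕ} {f : E (n + 1) → ℝ} {k r₁ r₂ : ℝ}

lemma Q_hasDeriv (hf : GoodPrescribed f k r₁ r₂) {x : E (n + 1)} (hx : ‖x‖ = 1) {r : ℝ}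
    (hr : 0 < r) : HasDerivAt (fun s : ℝ => s ^ (-k) * f (s • x))
      ((-k) * r ^ (-k - 1) * f (r • x) + r ^ (-k) * fderiv ℝ f (r • x) x) r := by
  have hx0 : x ≠ 0 := by
    rintro rfl
    simp at hx
  have h1 := Real.hasDerivAt_rpow_const (x := r) (p := -k) (Or.inl hr.ne')
  have h2 : DifferentiableAt ℝ f (r • x) :=
    (contDiffAt_of hf.1 (smul_ne_zero hr.ne' hx0)).differentiableAt (by simp)
  have h3 : HasDerivAt (fun s : ℝ => s • x) x r := by
    simpa using (hasDerivAt_id r).smul_const x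
  exact h1.mul (h2.hasFDerivAt.comp_hasDerivAt r h3)

lemma Q_strict (hf : GoodPrescribed f k r₁ r₂) {x : E (n + 1)} (hx : ‖x‖ = 1) :
    StrictMonoOn (fun s : ℝ => s ^ (-k) * f (s • x)) (Ioi 0) := by
  apply strictMonoOn_of_deriv_pos (convex_Ioi 0)
  · intro r hr
    exact (Q_hasDeriv hf hx hr).continuousAt.continuousWithinAt
  · intro r hr
    rw [interior_Ioi] at hr
    exact hf.2.2.1 x hx r hr

lemma exists_unit : ∃ x : E (n + 1), ‖x‖ = 1 := ⟨EuclideanSpace.single 0 1, by simp⟩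

lemma sphere_compact : IsCompact {x : E (n + 1) | ‖x‖ = 1} := by
  have : {x : E (n + 1) | ‖x‖ = 1} = Metric.sphere 0 1 := by ext; simp
  rw [this]; exact isCompact_sphere 0 1

lemma exists_lam (hf : GoodPrescribed f k r₁ r₂) {a b : ℝ} (ha : 0 < a) (hab : a ≤ b) :
    ∃ lam : ℝ, 0 < lam ∧ ∀ x : E (n + 1), ‖x‖ = 1 → ∀ r ∈ Icc a b, ∀ r' ∈ Icc a b,
      ∀ s ∈ Icc a b, r ≤ r' → lam * (Real.log r' - Real.log r) ≤
        s ^ (k - 1) * (r' ^ (-k) * f (r' • x) - r ^ (-k) * f (r • x)) := by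
  have hKc : IsCompact (Icc a b ×ˢ {x : E (n + 1) | ‖x‖ = 1}) := isCompact_Icc.prod sphere_compact
  obtain ⟨x₀, hx₀⟩ := exists_unit (n := n)
  have hne : (Icc a b ×ˢ {x : E (n + 1) | ‖x‖ = 1}).Nonempty := ⟨(a, x₀), ⟨le_refl _, hab⟩, hx₀⟩
  set G : ℝ × E (n + 1) → ℝ := fun p => p.1 * ((-k) * p.1 ^ (-k - 1) * f (p.1 • p.2)
    + p.1 ^ (-k) * fderiv ℝ f (p.1 • p.2) p.2) with hG
  have hmaps : MapsTo (fun p : ℝ × E (n + 1) => p.1 • p.2) (Icc a b ×ˢ {x | ‖x‖ = 1})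
      {X | X ≠ 0} := by
    rintro ⟨r, x⟩ ⟨hr, hx⟩
    have hx0 : x ≠ 0 := by
      rintro rfl
      simp at hx
    exact smul_ne_zero (ha.trans_le hr.1).ne' hx0
  have hsm : ContinuousOn (fun p : ℝ × E (n + 1) => p.1 • p.2) (Icc a b ×ˢ {x | ‖x‖ = 1}) := by
    fun_prop
  have hcf : ContinuousOn (fun p : ℝ × E (n + 1) => f (p.1 • p.2)) (Icc a b ×ˢ {x | ‖x‖ = 1}) :=
    hf.1.continuousOn.comp hsm hmaps
  have hcd : ContinuousOn (fun p : ℝ × E (n + 1) => fderiv ℝ f (p.1 • p.2))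
      (Icc a b ×ˢ {x | ‖x‖ = 1}) :=
    (hf.1.continuousOn_fderiv_of_isOpen isOpen_ne (by simp)).comp hsm hmaps
  have hpw : ∀ q : ℝ, ContinuousOn (fun p : ℝ × E (n + 1) => p.1 ^ q)
      (Icc a b ×ˢ {x | ‖x‖ = 1}) := by
    intro q
    apply ContinuousOn.rpow_const continuous_fst.continuousOn
    rintro ⟨r, x⟩ ⟨hr, hx⟩
    exact Or.inl (ha.trans_le hr.1).ne'
  have hGc : ContinuousOn G (Icc a b ×ˢ {x | ‖x‖ = 1}) := by
    apply continuous_fst.continuousOn.mul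
    apply ContinuousOn.add
    · exact (continuousOn_const.mul (hpw _)).mul hcf
    · exact (hpw _).mul (hcd.clm_apply continuous_snd.continuousOn)
  obtain ⟨p₀, hp₀, hmin⟩ := hKc.exists_isMinOn hne hGc
  have hδ : 0 < G p₀ := by
    have h1 := hf.2.2.1 p₀.2 hp₀.2 p₀.1 (ha.trans_le hp₀.1.1)
    rw [(Q_hasDeriv hf hp₀.2 (ha.trans_le hp₀.1.1)).deriv] at h1
    exact mul_pos (ha.trans_le hp₀.1.1) h1
  have hpc : ContinuousOn (fun s : ℝ => s ^ (k - 1)) (Icc a b) := by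
    apply ContinuousOn.rpow_const continuousOn_id
    intro r hr
    exact Or.inl (ha.trans_le hr.1).ne'
  obtain ⟨s₀, hs₀, hsmin⟩ := isCompact_Icc.exists_isMinOn (nonempty_Icc.mpr hab) hpc
  have hc0 : 0 < s₀ ^ (k - 1) := Real.rpow_pos_of_pos (ha.trans_le hs₀.1) _
  refine ⟨s₀ ^ (k - 1) * G p₀, mul_pos hc0 hδ, ?_⟩
  intro x hx r hr r' hr' s hs hrr
  have hdd : ∀ q ∈ Icc a b, HasDerivAt
      (fun s : ℝ => s ^ (-k) * f (s • x) - G p₀ * Real.log s)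
      ((-k) * q ^ (-k - 1) * f (q • x) + q ^ (-k) * fderiv ℝ f (q • x) x - G p₀ * q⁻¹) q := by
    intro q hq
    have hq0 := ha.trans_le hq.1
    exact (Q_hasDeriv hf hx hq0).sub ((Real.hasDerivAt_log hq0.ne').const_mul _)
  have hmono : MonotoneOn (fun s : ℝ => s ^ (-k) * f (s • x) - G p₀ * Real.log s) (Icc a b) := by
    apply monotoneOn_of_deriv_nonneg (convex_Icc a b)
    · intro q hq
      exact (hdd q hq).continuousAt.continuousWithinAt
    · intro q hq
      exact (hdd q (interior_subset hq)).differentiableAt.differentiableWithinAt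
    · intro q hq
      have hq := interior_subset hq
      have hq0 := ha.trans_le hq.1
      rw [(hdd q hq).deriv]
      have h1 : G p₀ ≤ G (q, x) := hmin ⟨hq, hx⟩
      have h2 : G p₀ * q⁻¹ ≤ G (q, x) * q⁻¹ := mul_le_mul_of_nonneg_right h1 (by positivity)
      have h3 : G (q, x) * q⁻¹ = (-k) * q ^ (-k - 1) * f (q • x)
          + q ^ (-k) * fderiv ℝ f (q • x) x := by
        simp only [hG]
        field_simp
      linarith
  have h1 := hmono hr hr' hrr
  simp only at h1
  have h2 : s₀ ^ (k - 1) ≤ s ^ (k - 1) := hsmin hs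
  have h3 : Real.log r ≤ Real.log r' := Real.log_le_log (ha.trans_le hr.1) hrr
  have h4 : G p₀ * (Real.log r' - Real.log r) ≤ r' ^ (-k) * f (r' • x) - r ^ (-k) * f (r • x) := by
    linarith
  have h5 : 0 ≤ G p₀ * (Real.log r' - Real.log r) := mul_nonneg hδ.le (by linarith)
  calc s₀ ^ (k - 1) * G p₀ * (Real.log r' - Real.log r)
      = s₀ ^ (k - 1) * (G p₀ * (Real.log r' - Real.log r)) := by ring
    _ ≤ _ := mul_le_mul h2 h4 h5 (hc0.le.trans h2)

variable {Γ : Set (Fin n → ℝ)} {F : (Fin n → ℝ) → ℝ}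

lemma touch_calF (hΓ : GoodCone Γ) (hF : GoodF Γ F k) (hf : GoodPrescribed f k r₁ r₂)
    {ρ₁ ρ₂ : E (n + 1) → ℝ} (h₁ : ContDiffOn ℝ (⊤ : ℕ∞) ρ₁ {y | y ≠ 0})
    (h₂ : ContDiffOn ℝ (⊤ : ℕ∞) ρ₂ {y | y ≠ 0})
    (hh₁ : ∀ c : ℝ, 0 < c → ∀ y, ρ₁ (c • y) = ρ₁ y)
    (hh₂ : ∀ c : ℝ, 0 < c → ∀ y, ρ₂ (c • y) = ρ₂ y)
    {x : E (n + 1)} (hx : ‖x‖ = 1) {c : ℝ} (hc : 1 < c)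
    (hle : ∀ y, ‖y‖ = 1 → ρ₁ y ≤ c * ρ₂ y) (heq : ρ₁ x = c * ρ₂ x) (hpos : 0 < ρ₂ x)
    {κ₁ κ₂ : Fin n → ℝ} (hκ₁ : κ₁ ∈ Γ)
    (hκ₂ : κ₂ ∈ Γ) (hp₁ : HasPrincCurv ρ₁ x κ₁) (hp₂ : HasPrincCurv ρ₂ x κ₂) :
    calF F f ρ₁ x κ₁ / ρ₁ x < c ^ (k - 1) * (calF F f ρ₂ x κ₂ / ρ₂ x) := by
  have hx0 : x ≠ 0 := by
    rintro rfl
    simp at hx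
  have hc0 : 0 < c := by linarith
  obtain ⟨hg, hh⟩ := touch h₁ h₂ hh₁ hh₂ hx hle heq
  have hFF := touch_F hΓ hF hx0 (contDiffAt_of h₁ hx0) (contDiffAt_of h₂ hx0) hc0 hpos heq hg hh
    hκ₁ hκ₂ hp₁ hp₂
  have hq := Q_strict hf hx (show ρ₂ x ∈ Ioi 0 from hpos)
    (show c * ρ₂ x ∈ Ioi 0 from mul_pos hc0 hpos) (by nlinarith)
  simp only at hq
  have F1 := hF.1 _ hκ₁
  have F2 := hF.1 _ hκ₂
  rw [Real.mul_rpow hc0.le hpos.le, Real.rpow_neg hc0.le] at hq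
  have hp : 0 < ρ₂ x ^ (-k) := Real.rpow_pos_of_pos hpos _
  have hck : 0 < c ^ k := Real.rpow_pos_of_pos hc0 _
  have hq' : c ^ k * f (ρ₂ x • x) < f ((c * ρ₂ x) • x) := by
    have e : (c ^ k)⁻¹ * ρ₂ x ^ (-k) * f ((c * ρ₂ x) • x)
      = ρ₂ x ^ (-k) * ((c ^ k)⁻¹ * f ((c * ρ₂ x) • x)) := by ring
    rw [e] at hq
    have := lt_of_mul_lt_mul_left hq hp.le
    rwa [lt_inv_mul_iff₀ hck] at this
  have hF' : 1 / F κ₁ ≤ c ^ k * (1 / F κ₂) := by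
    rw [mul_one_div, div_le_div_iff₀ F1 F2]; linarith
  have hW : 0 < Real.sqrt ((ρ₂ x) ^ 2 + ‖gradient ρ₂ x‖ ^ 2) := by positivity
  simp only [calF]
  rw [heq, hg, W_scale hc0, Real.rpow_sub_one hc0.ne']
  set W := Real.sqrt ((ρ₂ x) ^ 2 + ‖gradient ρ₂ x‖ ^ 2)
  have e1 : (1 / F κ₁ - f ((c * ρ₂ x) • x)) * (c * W) / (c * ρ₂ x) / (c * ρ₂ x)
    = (1 / F κ₁ - f ((c * ρ₂ x) • x)) * (W / (c * ρ₂ x ^ 2)) := by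
    field_simp
  have e2 : c ^ k / c * ((1 / F κ₂ - f (ρ₂ x • x)) * W / ρ₂ x / ρ₂ x)
    = (c ^ k * (1 / F κ₂) - c ^ k * f (ρ₂ x • x)) * (W / (c * ρ₂ x ^ 2)) := by
    field_simp
  rw [e1, e2]
  apply mul_lt_mul_of_pos_right _ (by positivity)
  linarith

lemma scale_calF (hF : GoodF Γ F k) {ρ : E (n + 1) → ℝ} {x : E (n + 1)}
    {c : ℝ} (hc : 0 < c) (hpos : 0 < ρ x) {κ : Fin n → ℝ} (hκ : κ ∈ Γ) :
    calF F f (fun y => c * ρ y) x (c⁻¹ • κ) / (c * ρ x) = c ^ (k - 1) * (calF F f ρ x κ / ρ x)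
      - (c * ρ x) ^ (k - 1) * ((c * ρ x) ^ (-k) * f ((c * ρ x) • x) - ρ x ^ (-k) * f (ρ x • x))
        * (Real.sqrt ((ρ x) ^ 2 + ‖gradient ρ x‖ ^ 2) / ρ x) := by
  have F1 := hF.1 _ hκ
  have hck : 0 < c ^ k := Real.rpow_pos_of_pos hc _
  have hrk : 0 < (ρ x) ^ k := Real.rpow_pos_of_pos hpos _
  simp only [calF, grad_scale]
  rw [W_scale hc, hF.2.2.2.2.1 _ _ hκ (inv_pos.mpr hc), Real.inv_rpow hc.le,
    Real.rpow_sub_one hc.ne', Real.rpow_sub_one (mul_pos hc hpos).ne', Real.rpow_neg (mul_pos hc hpos).le,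
    Real.rpow_neg hpos.le, Real.mul_rpow hc.le hpos.le]
  field_simp
  ring

lemma W_ge {a : ℝ} (ha : 0 < a) (b : ℝ) : 1 ≤ Real.sqrt (a ^ 2 + b ^ 2) / a := by
  rw [one_le_div ha]
  apply Real.le_sqrt_of_sq_le
  nlinarith [sq_nonneg b]

lemma scale_up (hF : GoodF Γ F k) {ρ : E (n + 1) → ℝ} {x : E (n + 1)}
    {c : ℝ} (hc : 0 < c) (hpos : 0 < ρ x) {κ : Fin n → ℝ} (hκ : κ ∈ Γ) {L : ℝ} (hL0 : 0 ≤ L)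
    (hL : L ≤ (c * ρ x) ^ (k - 1) *
      ((c * ρ x) ^ (-k) * f ((c * ρ x) • x) - ρ x ^ (-k) * f (ρ x • x))) :
    calF F f (fun y => c * ρ y) x (c⁻¹ • κ) / (c * ρ x)
      ≤ c ^ (k - 1) * (calF F f ρ x κ / ρ x) - L := by
  rw [scale_calF hF hc hpos hκ]
  have := W_ge hpos ‖gradient ρ x‖
  nlinarith

lemma scale_down (hF : GoodF Γ F k) {ρ : E (n + 1) → ℝ} {x : E (n + 1)}
    {c : ℝ} (hc : 0 < c) (hpos : 0 < ρ x) {κ : Fin n → ℝ} (hκ : κ ∈ Γ) {L : ℝ} (hL0 : 0 ≤ L)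
    (hL : L ≤ (c * ρ x) ^ (k - 1) *
      (ρ x ^ (-k) * f (ρ x • x) - (c * ρ x) ^ (-k) * f ((c * ρ x) • x))) :
    c ^ (k - 1) * (calF F f ρ x κ / ρ x) + L ≤
      calF F f (fun y => c * ρ y) x (c⁻¹ • κ) / (c * ρ x) := by
  rw [scale_calF hF hc hpos hκ]
  have := W_ge hpos ‖gradient ρ x‖
  nlinarith

lemma const_curv {r : ℝ} (hr : 0 < r) {x : E (n + 1)} (hx : ‖x‖ = 1) :
    HasPrincCurv (fun _ : E (n + 1) => r) x (r⁻¹ • fun _ : Fin n => (1:ℝ)) := by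
  have hx0 : x ≠ 0 := by
    rintro rfl
    simp at hx
  have : Fact (Module.finrank ℝ (E (n + 1)) = n + 1) := ⟨by simp⟩
  have f3 : Module.finrank ℝ (Submodule.span ℝ {x})ᗮ = n :=
    Submodule.finrank_orthogonal_span_singleton hx0
  let b := (stdOrthonormalBasis ℝ (Submodule.span ℝ {x})ᗮ).reindex (finCongr f3)
  refine ⟨fun i => (b i : E (n + 1)), ?_, ?_, ?_⟩
  · exact b.orthonormal.linearIndependent.map' (Submodule.subtype _) (Submodule.ker_subtype _)
  · intro i
    exact Submodule.mem_orthogonal_singleton_iff_inner_right.mp (b i).2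
  · intro i u hu
    have hg : gradient (fun _ : E (n + 1) => r) = fun _ => 0 := by
      funext y; exact gradient_fun_const y r
    simp only [hForm, gForm, hess, hg]
    simp [Real.sqrt_sq hr.le]
    field_simp

lemma const_calF (hΓ : GoodCone Γ) (hF : GoodF Γ F k) {r : ℝ} (hr : 0 < r) {x : E (n + 1)} :
    (r⁻¹ • fun _ : Fin n => (1:ℝ)) ∈ Γ ∧
    calF F f (fun _ : E (n + 1) => r) x (r⁻¹ • fun _ : Fin n => (1:ℝ)) = r ^ k - f (r • x) := by
  have h1 : (fun _ : Fin n => (1:ℝ)) ∈ Γ := hΓ.2.2.2.2.2 _ (fun _ => one_pos)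
  refine ⟨hΓ.2.2.2.1 _ _ h1 (inv_pos.mpr hr), ?_⟩
  have hg : gradient (fun _ : E (n + 1) => r) = fun _ => 0 := by
    funext y; exact gradient_fun_const y r
  simp only [calF, hg]
  rw [hF.2.2.2.2.1 _ _ h1 (inv_pos.mpr hr), hF.2.2.2.2.2.2, Real.inv_rpow hr.le]
  simp [Real.sqrt_sq hr.le, hr.ne']

end
open Filter Topology in
lemma deriv_nonneg_right {H : ℝ → ℝ} {d a b : ℝ} (hab : a < b) (h : HasDerivAt H d a)
    (hH : ∀ s ∈ Ioo a b, H a ≤ H s) : 0 ≤ d := by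
  have h1 := (hasDerivWithinAt_iff_tendsto_slope' (s := Ioi a) (by simp)).mp
    (h.hasDerivWithinAt (s := Ioi a))
  refine ge_of_tendsto h1 ?_
  filter_upwards [Ioo_mem_nhdsGT hab] with s hs
  rw [slope_def_field]
  exact div_nonneg (by linarith [hH s hs]) (by linarith [hs.1])

open Filter Topology in
lemma deriv_nonneg_left {H : ℝ → ℝ} {d a b : ℝ} (hab : b < a) (h : HasDerivAt H d a)
    (hH : ∀ s ∈ Ioo b a, H s ≤ H a) : 0 ≤ d := by
  have h1 := (hasDerivWithinAt_iff_tendsto_slope' (s := Iio a) (by simp)).mp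
    (h.hasDerivWithinAt (s := Iio a))
  refine ge_of_tendsto h1 ?_
  filter_upwards [Ioo_mem_nhdsLT hab] with s hs
  rw [slope_def_field]
  exact div_nonneg_of_nonpos (by linarith [hH s hs]) (by linarith [hs.2])

lemma abs_exp_sub_one_le' (y : ℝ) : |Real.exp y - 1| ≤ |y| * Real.exp |y| := by
  rcases le_total 0 y with h | h
  · rw [abs_of_nonneg h, abs_of_nonneg (by linarith [Real.add_one_le_exp y])]
    have h1 := Real.add_one_le_exp (-y)
    have h2 := mul_le_mul_of_nonneg_right h1 (Real.exp_pos y).le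
    rw [← Real.exp_add] at h2
    simp at h2
    linarith
  · rw [abs_of_nonpos h, abs_of_nonpos (by linarith [Real.exp_le_one_iff.mpr h])]
    have h1 := Real.add_one_le_exp y
    have h2 := Real.one_le_exp (neg_nonneg.mpr h)
    nlinarith

structure Reg {n : ℕ} (T : ℝ) (ρ : ℝ → E (n + 1) → ℝ) : Prop where
  sm : ContDiffOn ℝ (⊤ : ℕ∞) (fun p : ℝ × E (n + 1) => ρ p.1 p.2) (univ ×ˢ {y | y ≠ 0})
  hom : ∀ t ∈ Icc (0 : ℝ) T, ∀ c : ℝ, 0 < c → ∀ y : E (n + 1), ρ t (c • y) = ρ t y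
  pos : ∀ t ∈ Icc (0 : ℝ) T, ∀ x : E (n + 1), ‖x‖ = 1 → 0 < ρ t x

section
variable {n : ℕ} {T : ℝ} {ρ : ℝ → E (n + 1) → ℝ}

lemma ne_zero_of_unit {x : E (n + 1)} (hx : ‖x‖ = 1) : x ≠ 0 := by
  rintro rfl
  simp at hx

lemma isOpen_dom : IsOpen ((univ : Set ℝ) ×ˢ {y : E (n + 1) | y ≠ 0}) :=
  isOpen_univ.prod isOpen_ne

lemma slice_smooth
    (h : ContDiffOn ℝ (⊤ : ℕ∞) (fun p : ℝ × E (n + 1) => ρ p.1 p.2) (univ ×ˢ {y | y ≠ 0})) (t : ℝ) :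
    ContDiffOn ℝ (⊤ : ℕ∞) (ρ t) {y | y ≠ 0} :=
  h.comp (f := fun y => (t, y)) (contDiff_const.prodMk contDiff_id).contDiffOn
    (fun y hy => ⟨mem_univ _, hy⟩)

lemma time_smooth
    (h : ContDiffOn ℝ (⊤ : ℕ∞) (fun p : ℝ × E (n + 1) => ρ p.1 p.2) (univ ×ˢ {y | y ≠ 0}))
    {x : E (n + 1)} (hx : x ≠ 0) :
    ContDiff ℝ (⊤ : ℕ∞) (fun s => ρ s x) := by
  rw [← contDiffOn_univ]
  exact h.comp (f := fun s => (s, x)) (contDiff_id.prodMk contDiff_const).contDiffOn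
    (fun y hy => ⟨mem_univ _, hx⟩)

lemma time_deriv
    (h : ContDiffOn ℝ (⊤ : ℕ∞) (fun p : ℝ × E (n + 1) => ρ p.1 p.2) (univ ×ˢ {y | y ≠ 0}))
    {x : E (n + 1)} (hx : x ≠ 0) (t : ℝ) :
    HasDerivAt (fun s => ρ s x) (deriv (fun s => ρ s x) t) t :=
  ((time_smooth h hx).differentiable (by simp) t).hasDerivAt

lemma time_deriv_cont
    (h : ContDiffOn ℝ (⊤ : ℕ∞) (fun p : ℝ × E (n + 1) => ρ p.1 p.2) (univ ×ˢ {y | y ≠ 0})) :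
    ContinuousOn (fun p : ℝ × E (n + 1) => deriv (fun s => ρ s p.2) p.1)
      (univ ×ˢ {y | y ≠ 0}) := by
  have h1 := h.continuousOn_fderiv_of_isOpen isOpen_dom (by simp)
  have h2 : ContinuousOn (fun p : ℝ × E (n + 1) =>
      fderiv ℝ (fun p : ℝ × E (n + 1) => ρ p.1 p.2) p (1, 0)) (univ ×ˢ {y | y ≠ 0}) :=
    h1.clm_apply continuousOn_const
  refine h2.congr ?_
  rintro ⟨t, x⟩ hp
  have h3 : DifferentiableAt ℝ (fun p : ℝ × E (n + 1) => ρ p.1 p.2) (t, x) :=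
    (h.contDiffAt (isOpen_dom.mem_nhds hp)).differentiableAt (by simp)
  have h4 : HasDerivAt (fun s : ℝ => (s, x)) ((1 : ℝ), (0 : E (n + 1))) t :=
    (hasDerivAt_id t).prodMk (hasDerivAt_const t x)
  exact (h3.hasFDerivAt.comp_hasDerivAt t h4).deriv

def IsSub (Γ : Set (Fin n → ℝ)) (F : (Fin n → ℝ) → ℝ) (f : E (n + 1) → ℝ) (T : ℝ)
    (ρ : ℝ → E (n + 1) → ℝ) : Prop :=
  ∀ t ∈ Icc (0 : ℝ) T, ∀ x : E (n + 1), ‖x‖ = 1 → ∃ κ ∈ Γ, HasPrincCurv (ρ t) x κ ∧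
    deriv (fun s => ρ s x) t ≤ calF F f (ρ t) x κ

def IsSuper (Γ : Set (Fin n → ℝ)) (F : (Fin n → ℝ) → ℝ) (f : E (n + 1) → ℝ) (T : ℝ)
    (ρ : ℝ → E (n + 1) → ℝ) : Prop :=
  ∀ t ∈ Icc (0 : ℝ) T, ∀ x : E (n + 1), ‖x‖ = 1 → ∃ κ ∈ Γ, HasPrincCurv (ρ t) x κ ∧
    calF F f (ρ t) x κ ≤ deriv (fun s => ρ s x) t

theorem comparison {Γ : Set (Fin n → ℝ)} {F : (Fin n → ℝ) → ℝ} {f : E (n + 1) → ℝ}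
    {k r₁ r₂ : ℝ} (hΓ : GoodCone Γ) (hF : GoodF Γ F k) (hf : GoodPrescribed f k r₁ r₂)
    {ρ₁ ρ₂ : ℝ → E (n + 1) → ℝ} (R₁ : Reg T ρ₁) (R₂ : Reg T ρ₂)
    (hsub : IsSub Γ F f T ρ₁) (hsup : IsSuper Γ F f T ρ₂)
    (hinit : ∀ x, ‖x‖ = 1 → ρ₁ 0 x ≤ ρ₂ 0 x) :
    ∀ t ∈ Icc (0 : ℝ) T, ∀ x, ‖x‖ = 1 → ρ₁ t x ≤ ρ₂ t x := by
  intro t ht x hx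
  by_contra hcon
  push Not at hcon
  set K : Set (ℝ × E (n + 1)) := Icc (0:ℝ) T ×ˢ {x : E (n + 1) | ‖x‖ = 1} with hK
  have hKc : IsCompact K := isCompact_Icc.prod sphere_compact
  have hKd : K ⊆ univ ×ˢ {y | y ≠ 0} := fun p hp => ⟨mem_univ _, ne_zero_of_unit hp.2⟩
  set u : ℝ × E (n + 1) → ℝ := fun p => Real.log (ρ₁ p.1 p.2) - Real.log (ρ₂ p.1 p.2) with hu
  have huc : ContinuousOn u K := by
    apply ContinuousOn.sub
    · exact (R₁.sm.continuousOn.mono hKd).log (fun p hp => (R₁.pos _ hp.1 _ hp.2).ne')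
    · exact (R₂.sm.continuousOn.mono hKd).log (fun p hp => (R₂.pos _ hp.1 _ hp.2).ne')
  set φ : ℝ × E (n + 1) → ℝ := fun p => deriv (fun s => ρ₂ s p.2) p.1 / ρ₂ p.1 p.2 with hφ
  have hφc : ContinuousOn φ K :=
    ((time_deriv_cont R₂.sm).mono hKd).div (R₂.sm.continuousOn.mono hKd)
      (fun p hp => (R₂.pos _ hp.1 _ hp.2).ne')
  obtain ⟨U, hU⟩ := hKc.exists_bound_of_continuousOn huc
  obtain ⟨B, hB⟩ := hKc.exists_bound_of_continuousOn hφc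
  set A := B * (|k - 1| * Real.exp (|k - 1| * U)) with hA
  set v : ℝ × E (n + 1) → ℝ := fun p => Real.exp (-A * p.1) * u p with hv
  have hvc : ContinuousOn v K := by
    apply ContinuousOn.mul _ huc
    fun_prop
  obtain ⟨⟨t₀, x₀⟩, hp₀, hmax⟩ := hKc.exists_isMaxOn ⟨(t, x), ht, hx⟩ hvc
  have ht₀ : t₀ ∈ Icc 0 T := hp₀.1
  have hx₀ : ‖x₀‖ = 1 := hp₀.2
  have hmax' : ∀ p ∈ K, v p ≤ v (t₀, x₀) := fun p hp => hmax hp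
  have hut : 0 < u (t, x) := by
    simp only [hu]
    linarith [Real.log_lt_log (R₂.pos t ht x hx) hcon]
  have hvt : 0 < v (t, x) := mul_pos (Real.exp_pos _) hut
  have hv0 : 0 < v (t₀, x₀) := hvt.trans_le (hmax' _ ⟨ht, hx⟩)
  have hu0 : 0 < u (t₀, x₀) := (mul_pos_iff_of_pos_left (Real.exp_pos _)).mp hv0
  have ht0 : 0 < t₀ := by
    rcases ht₀.1.eq_or_lt with h | h
    · exfalso
      have h1 := hinit x₀ hx₀
      have h2 := R₁.pos _ ht₀ _ hx₀
      rw [← h] at h2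
      have h3 := Real.log_le_log h2 h1
      simp only [hu, ← h] at hu0
      linarith
    · exact h
  have P1 : ∀ y, ‖y‖ = 1 → 0 < ρ₁ t₀ y := R₁.pos t₀ ht₀
  have P2 : ∀ y, ‖y‖ = 1 → 0 < ρ₂ t₀ y := R₂.pos t₀ ht₀
  set c := Real.exp (u (t₀, x₀)) with hc
  have hc1 : 1 < c := Real.one_lt_exp_iff.mpr hu0
  have hexp : ∀ y, ‖y‖ = 1 → ρ₁ t₀ y = Real.exp (u (t₀, y)) * ρ₂ t₀ y := by
    intro y hy
    simp only [hu]
    rw [Real.exp_sub, Real.exp_log (P1 y hy), Real.exp_log (P2 y hy)]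
    have := (P2 y hy).ne'
    field_simp
  have hle : ∀ y, ‖y‖ = 1 → ρ₁ t₀ y ≤ c * ρ₂ t₀ y := by
    intro y hy
    rw [hexp y hy]
    apply mul_le_mul_of_nonneg_right _ (P2 y hy).le
    apply Real.exp_le_exp.mpr
    have := hmax' (t₀, y) ⟨ht₀, hy⟩
    simp only [hv] at this
    exact le_of_mul_le_mul_left this (Real.exp_pos _)
  obtain ⟨κ₁, hκ₁, hpc₁, hd₁⟩ := hsub t₀ ht₀ x₀ hx₀
  obtain ⟨κ₂, hκ₂, hpc₂, hd₂⟩ := hsup t₀ ht₀ x₀ hx₀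
  have key := touch_calF hΓ hF hf (slice_smooth R₁.sm t₀) (slice_smooth R₂.sm t₀)
    (R₁.hom t₀ ht₀) (R₂.hom t₀ ht₀) hx₀ hc1 hle (hexp x₀ hx₀) (P2 x₀ hx₀) hκ₁ hκ₂ hpc₁ hpc₂
  have hx0 := ne_zero_of_unit hx₀
  have D1 := (time_deriv R₁.sm hx0 t₀).log (P1 x₀ hx₀).ne'
  have D2 := (time_deriv R₂.sm hx0 t₀).log (P2 x₀ hx₀).ne'
  set d₁ := deriv (fun s => ρ₁ s x₀) t₀
  set d₂ := deriv (fun s => ρ₂ s x₀) t₀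
  have q1 : d₁ / ρ₁ t₀ x₀ ≤ calF F f (ρ₁ t₀) x₀ κ₁ / ρ₁ t₀ x₀ :=
    div_le_div_of_nonneg_right hd₁ (P1 x₀ hx₀).le
  have q2 : calF F f (ρ₂ t₀) x₀ κ₂ / ρ₂ t₀ x₀ ≤ d₂ / ρ₂ t₀ x₀ :=
    div_le_div_of_nonneg_right hd₂ (P2 x₀ hx₀).le
  have q3 := mul_le_mul_of_nonneg_left q2 (Real.rpow_nonneg (by linarith : (0:ℝ) ≤ c) (k - 1))
  have DE : HasDerivAt (fun s : ℝ => Real.exp (-A * s)) (Real.exp (-A * t₀) * (-A)) t₀ := by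
    have := ((hasDerivAt_id t₀).const_mul (-A)).exp
    simpa using this
  have DV := DE.mul (D1.sub D2)
  have hnn := deriv_nonneg_left ht0 DV (by
    intro s hs
    exact hmax' (s, x₀) ⟨⟨hs.1.le, hs.2.le.trans ht₀.2⟩, hx₀⟩)
  have hu00 : Real.log (ρ₁ t₀ x₀) - Real.log (ρ₂ t₀ x₀) = u (t₀, x₀) := rfl
  simp only [Pi.sub_apply, hu00] at hnn
  have hnn2 : 0 ≤ Real.exp (-A * t₀) *
      (d₁ / ρ₁ t₀ x₀ - d₂ / ρ₂ t₀ x₀ - A * u (t₀, x₀)) := by linarith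
  have hnn3 := (mul_nonneg_iff_of_pos_left (Real.exp_pos _)).mp hnn2
  have hck : c ^ (k - 1) = Real.exp (u (t₀, x₀) * (k - 1)) := by
    rw [hc, ← Real.exp_mul]
  have hb := hB (t₀, x₀) hp₀
  have hUU := hU (t₀, x₀) hp₀
  rw [Real.norm_eq_abs] at hb hUU
  rw [abs_of_pos hu0] at hUU
  have h5 := abs_exp_sub_one_le' (u (t₀, x₀) * (k - 1))
  rw [← hck, abs_mul, abs_of_pos hu0] at h5
  have h6 : u (t₀, x₀) * |k - 1| * Real.exp (u (t₀, x₀) * |k - 1|)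
      ≤ u (t₀, x₀) * |k - 1| * Real.exp (|k - 1| * U) := by
    apply mul_le_mul_of_nonneg_left _ (by positivity)
    apply Real.exp_le_exp.mpr
    rw [mul_comm]
    exact mul_le_mul_of_nonneg_left hUU (abs_nonneg _)
  have h7 : (c ^ (k - 1) - 1) * φ (t₀, x₀) ≤ |c ^ (k - 1) - 1| * B := by
    refine (le_abs_self _).trans ?_
    rw [abs_mul]
    exact mul_le_mul_of_nonneg_left hb (abs_nonneg _)
  have hB0 : 0 ≤ B := (abs_nonneg _).trans hb
  have h8 := mul_le_mul_of_nonneg_right (h5.trans h6) hB0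
  have h9 : φ (t₀, x₀) = d₂ / ρ₂ t₀ x₀ := rfl
  rw [h9] at h7
  have h10 : A * u (t₀, x₀) = u (t₀, x₀) * |k - 1| * Real.exp (|k - 1| * U) * B := by
    rw [hA]; ring
  linarith

end
section
variable {n : ℕ} {T : ℝ} {ρ : ℝ → E (n + 1) → ℝ} {Γ : Set (Fin n → ℝ)} {F : (Fin n → ℝ) → ℝ}
  {f : E (n + 1) → ℝ} {k r₁ r₂ : ℝ} {ρ₀ : E (n + 1) → ℝ}

lemma Reg.const {r : ℝ} (hr : 0 < r) : Reg T (fun (_ : ℝ) (_ : E (n + 1)) => r) :=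
  ⟨contDiffOn_const, fun _ _ _ _ _ => rfl, fun _ _ _ _ => hr⟩

lemma Reg.static (h : GoodInit ρ₀) : Reg T (fun _ => ρ₀) :=
  ⟨h.1.comp (f := fun p : ℝ × E (n + 1) => p.2) contDiff_snd.contDiffOn (fun p hp => hp.2),
    fun _ _ => h.2.1, fun _ _ => h.2.2⟩

lemma Reg.scale (h : Reg T ρ) {c : ℝ → ℝ} (hc : ContDiff ℝ (⊤ : ℕ∞) c) (hp : ∀ t, 0 < c t) :
    Reg T (fun t y => c t * ρ t y) :=
  ⟨((hc.comp contDiff_fst).contDiffOn).mul h.sm,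
    fun t ht a ha y => by rw [h.hom t ht a ha y],
    fun t ht x hx => mul_pos (hp t) (h.pos t ht x hx)⟩

lemma Reg.shift (h : Reg T ρ) {s : ℝ} (hs : 0 ≤ s) : Reg (T - s) (fun t y => ρ (t + s) y) :=
  ⟨h.sm.comp (f := fun p : ℝ × E (n + 1) => (p.1 + s, p.2))
    ((contDiff_fst.add contDiff_const).prodMk contDiff_snd).contDiffOn
      (fun p hp => ⟨mem_univ _, hp.2⟩),
    fun t ht => h.hom _ ⟨by linarith [ht.1], by linarith [ht.2]⟩,
    fun t ht => h.pos _ ⟨by linarith [ht.1], by linarith [ht.2]⟩⟩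

lemma Reg.restrict (h : Reg T ρ) {T' : ℝ} (hs : T' ≤ T) : Reg T' ρ :=
  ⟨h.sm, fun t ht => h.hom t ⟨ht.1, ht.2.trans hs⟩, fun t ht => h.pos t ⟨ht.1, ht.2.trans hs⟩⟩

lemma flow_reg (h : IsFlowSol Γ F f T ρ ρ₀) : Reg T ρ := ⟨h.1, h.2.1, h.2.2.1⟩

lemma flow_sub (h : IsFlowSol Γ F f T ρ ρ₀) : IsSub Γ F f T ρ := by
  intro t ht x hx
  obtain ⟨κ, hκ, hp⟩ := h.2.2.2.1 t ht x hx
  exact ⟨κ, hκ, hp, (h.2.2.2.2.1 t ht x hx κ hp).le⟩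

lemma flow_super (h : IsFlowSol Γ F f T ρ ρ₀) : IsSuper Γ F f T ρ := by
  intro t ht x hx
  obtain ⟨κ, hκ, hp⟩ := h.2.2.2.1 t ht x hx
  exact ⟨κ, hκ, hp, (h.2.2.2.2.1 t ht x hx κ hp).ge⟩

lemma IsSub.restrict (h : IsSub Γ F f T ρ) {T' : ℝ} (hs : T' ≤ T) : IsSub Γ F f T' ρ :=
  fun t ht => h t ⟨ht.1, ht.2.trans hs⟩

lemma IsSuper.restrict (h : IsSuper Γ F f T ρ) {T' : ℝ} (hs : T' ≤ T) : IsSuper Γ F f T' ρ :=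
  fun t ht => h t ⟨ht.1, ht.2.trans hs⟩

lemma IsSub.shift (h : IsSub Γ F f T ρ) {s : ℝ} (hs : 0 ≤ s) :
    IsSub Γ F f (T - s) (fun t y => ρ (t + s) y) := by
  intro t ht x hx
  obtain ⟨κ, hκ, hp, hd⟩ := h (t + s) ⟨by linarith [ht.1], by linarith [ht.2]⟩ x hx
  refine ⟨κ, hκ, hp, ?_⟩
  rw [deriv_comp_add_const (f := fun s => ρ s x)]
  exact hd

lemma IsSuper.shift (h : IsSuper Γ F f T ρ) {s : ℝ} (hs : 0 ≤ s) :
    IsSuper Γ F f (T - s) (fun t y => ρ (t + s) y) := by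
  intro t ht x hx
  obtain ⟨κ, hκ, hp, hd⟩ := h (t + s) ⟨by linarith [ht.1], by linarith [ht.2]⟩ x hx
  refine ⟨κ, hκ, hp, ?_⟩
  rw [deriv_comp_add_const (f := fun s => ρ s x)]
  exact hd

lemma scaled_deriv (h : Reg T ρ) {g : ℝ → ℝ} (hg : ContDiff ℝ (⊤ : ℕ∞) g) {x : E (n + 1)}
    (hx : ‖x‖ = 1) {t : ℝ} (ht : t ∈ Icc 0 T) :
    deriv (fun s => Real.exp (g s) * ρ s x) t = (deriv g t + deriv (fun s => ρ s x) t / ρ t x)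
      * (Real.exp (g t) * ρ t x) := by
  have h1 := ((hg.differentiable (by simp) t).hasDerivAt.exp).mul
    (time_deriv h.sm (ne_zero_of_unit hx) t)
  have h2 := h1.deriv
  have hp := (h.pos t ht x hx).ne'
  refine h2.trans ?_
  field_simp

lemma super_scale (hΓ : GoodCone Γ) (hF : GoodF Γ F k) (hk : k ≤ 1) (h : Reg T ρ) {g : ℝ → ℝ}
    (hg : ContDiff ℝ (⊤ : ℕ∞) g) (hg0 : ∀ t ∈ Icc 0 T, 0 ≤ g t)
    (hyp : ∀ t ∈ Icc 0 T, ∀ x, ‖x‖ = 1 → ∃ κ ∈ Γ, HasPrincCurv (ρ t) x κ ∧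
      0 ≤ calF F f (ρ t) x κ ∧ ∃ L, 0 ≤ L ∧ L ≤ (Real.exp (g t) * ρ t x) ^ (k - 1) *
      ((Real.exp (g t) * ρ t x) ^ (-k) * f ((Real.exp (g t) * ρ t x) • x)
        - ρ t x ^ (-k) * f (ρ t x • x)) ∧
      calF F f (ρ t) x κ / ρ t x ≤ deriv (fun s => ρ s x) t / ρ t x + deriv g t + L) :
    IsSuper Γ F f T (fun t y => Real.exp (g t) * ρ t y) := by
  intro t ht x hx
  obtain ⟨κ, hκ, hp, h0, L, hL0, hL, hd⟩ := hyp t ht x hx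
  have hpos := h.pos t ht x hx
  have hc := Real.exp_pos (g t)
  refine ⟨(Real.exp (g t))⁻¹ • κ, hΓ.2.2.2.1 _ _ hκ (inv_pos.mpr hc), hp.scale hpos hc, ?_⟩
  rw [scaled_deriv h hg hx ht, ← div_le_iff₀ (mul_pos hc hpos)]
  have h1 := scale_up (f := f) hF hc hpos hκ hL0 hL
  have h2 : Real.exp (g t) ^ (k - 1) ≤ 1 :=
    Real.rpow_le_one_of_one_le_of_nonpos (Real.one_le_exp (hg0 t ht)) (by linarith)
  have h3 := mul_le_mul_of_nonneg_right h2 (div_nonneg h0 hpos.le)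
  linarith

lemma sub_scale (hΓ : GoodCone Γ) (hF : GoodF Γ F k) (hk : 1 < k) (h : Reg T ρ) {g : ℝ → ℝ}
    (hg : ContDiff ℝ (⊤ : ℕ∞) g) (hg0 : ∀ t ∈ Icc 0 T, g t ≤ 0)
    (hyp : ∀ t ∈ Icc 0 T, ∀ x, ‖x‖ = 1 → ∃ κ ∈ Γ, HasPrincCurv (ρ t) x κ ∧
      calF F f (ρ t) x κ ≤ 0 ∧ ∃ L, 0 ≤ L ∧ L ≤ (Real.exp (g t) * ρ t x) ^ (k - 1) *
      (ρ t x ^ (-k) * f (ρ t x • x)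
        - (Real.exp (g t) * ρ t x) ^ (-k) * f ((Real.exp (g t) * ρ t x) • x)) ∧
      deriv (fun s => ρ s x) t / ρ t x + deriv g t - L ≤ calF F f (ρ t) x κ / ρ t x) :
    IsSub Γ F f T (fun t y => Real.exp (g t) * ρ t y) := by
  intro t ht x hx
  obtain ⟨κ, hκ, hp, h0, L, hL0, hL, hd⟩ := hyp t ht x hx
  have hpos := h.pos t ht x hx
  have hc := Real.exp_pos (g t)
  refine ⟨(Real.exp (g t))⁻¹ • κ, hΓ.2.2.2.1 _ _ hκ (inv_pos.mpr hc), hp.scale hpos hc, ?_⟩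
  rw [scaled_deriv h hg hx ht, ← le_div_iff₀ (mul_pos hc hpos)]
  have h1 := scale_down (f := f) hF hc hpos hκ hL0 hL
  have h2 : Real.exp (g t) ^ (k - 1) ≤ 1 :=
    Real.rpow_le_one hc.le (Real.exp_le_one_iff.mpr (hg0 t ht)) (by linarith)
  have h3 := mul_le_mul_of_nonpos_right h2 (div_nonpos_of_nonpos_of_nonneg h0 hpos.le)
  linarith

lemma f_ge (hf : GoodPrescribed f k r₁ r₂) {x : E (n + 1)} (hx : ‖x‖ = 1) {r : ℝ} (hr : r₂ ≤ r) :
    r ^ k ≤ f (r • x) := by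
  have h2 : 0 < r₂ := hf.2.2.2.1.trans_le hf.2.2.2.2.1
  have h1 := (Q_strict hf hx).monotoneOn (show r₂ ∈ Ioi 0 from h2)
    (show r ∈ Ioi 0 from h2.trans_le hr) hr
  have h3 := hf.2.2.2.2.2.2 (r₂ • x) (by rw [norm_smul, hx, Real.norm_of_nonneg h2.le, mul_one])
  rw [Real.rpow_neg h2.le, Real.rpow_neg (h2.trans_le hr).le] at h1
  have p2 : 0 < r₂ ^ k := Real.rpow_pos_of_pos h2 _
  have p : 0 < r ^ k := Real.rpow_pos_of_pos (h2.trans_le hr) _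
  have h4 : 1 ≤ (r₂ ^ k)⁻¹ * f (r₂ • x) := by
    rw [le_inv_mul_iff₀ p2]; linarith
  have h5 := h4.trans h1
  rw [le_inv_mul_iff₀ p] at h5
  linarith

lemma f_le (hf : GoodPrescribed f k r₁ r₂) {x : E (n + 1)} (hx : ‖x‖ = 1) {r : ℝ} (hr0 : 0 < r)
    (hr : r ≤ r₁) : f (r • x) ≤ r ^ k := by
  have h2 : 0 < r₁ := hf.2.2.2.1
  have h1 := (Q_strict hf hx).monotoneOn (show r ∈ Ioi 0 from hr0) (show r₁ ∈ Ioi 0 from h2) hr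
  have h3 := hf.2.2.2.2.2.1 (r₁ • x) (by rw [norm_smul, hx, Real.norm_of_nonneg h2.le, mul_one])
  rw [Real.rpow_neg h2.le, Real.rpow_neg hr0.le] at h1
  have p2 : 0 < r₁ ^ k := Real.rpow_pos_of_pos h2 _
  have p : 0 < r ^ k := Real.rpow_pos_of_pos hr0 _
  have h4 : (r₁ ^ k)⁻¹ * f (r₁ • x) ≤ 1 := by
    rw [inv_mul_le_iff₀ p2]; linarith
  have h5 := h1.trans h4
  rw [inv_mul_le_iff₀ p] at h5
  linarith

lemma flow_le (hΓ : GoodCone Γ) (hF : GoodF Γ F k) (hf : GoodPrescribed f k r₁ r₂)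
    (h : IsFlowSol Γ F f T ρ ρ₀) {R : ℝ} (hR : r₂ ≤ R) (hρ₀ : ∀ x, ‖x‖ = 1 → ρ₀ x ≤ R) :
    ∀ t ∈ Icc (0 : ℝ) T, ∀ x, ‖x‖ = 1 → ρ t x ≤ R := by
  have hR0 : 0 < R := (hf.2.2.2.1.trans_le hf.2.2.2.2.1).trans_le hR
  refine comparison hΓ hF hf (flow_reg h) (Reg.const hR0) (flow_sub h) ?_ ?_
  · intro t ht x hx
    refine ⟨_, (const_calF (f := f) (x := x) hΓ hF hR0).1, const_curv hR0 hx, ?_⟩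
    rw [(const_calF (f := f) (x := x) hΓ hF hR0).2]
    simp only [deriv_const]
    linarith [f_ge hf hx hR]
  · intro x hx
    rw [h.2.2.2.2.2 x hx]
    exact hρ₀ x hx

lemma flow_ge (hΓ : GoodCone Γ) (hF : GoodF Γ F k) (hf : GoodPrescribed f k r₁ r₂)
    (h : IsFlowSol Γ F f T ρ ρ₀) {R : ℝ} (hR0 : 0 < R) (hR : R ≤ r₁)
    (hρ₀ : ∀ x, ‖x‖ = 1 → R ≤ ρ₀ x) :
    ∀ t ∈ Icc (0 : ℝ) T, ∀ x, ‖x‖ = 1 → R ≤ ρ t x := by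
  refine comparison hΓ hF hf (Reg.const hR0) (flow_reg h) ?_ (flow_super h) ?_
  · intro t ht x hx
    refine ⟨_, (const_calF (f := f) (x := x) hΓ hF hR0).1, const_curv hR0 hx, ?_⟩
    rw [(const_calF (f := f) (x := x) hΓ hF hR0).2]
    simp only [deriv_const]
    linarith [f_le hf hx hR0 hR]
  · intro x hx
    rw [h.2.2.2.2.2 x hx]
    exact hρ₀ x hx

lemma init_bounds (h : GoodInit ρ₀) (hr : 0 < r₁) :
    0 < min r₁ (sphMin ρ₀) ∧ ∀ x, ‖x‖ = 1 → min r₁ (sphMin ρ₀) ≤ ρ₀ x ∧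
      ρ₀ x ≤ max r₂ (sphMax ρ₀) := by
  have hc : ContinuousOn ρ₀ {x : E (n + 1) | ‖x‖ = 1} :=
    h.1.continuousOn.mono fun x hx => ne_zero_of_unit hx
  have hK := (sphere_compact (n := n)).image_of_continuousOn hc
  obtain ⟨x₀, hx₀⟩ := exists_unit (n := n)
  have hne : (ρ₀ '' {x : E (n + 1) | ‖x‖ = 1}).Nonempty := ⟨_, x₀, hx₀, rfl⟩
  refine ⟨lt_min hr ?_, fun x hx => ⟨?_, ?_⟩⟩
  · obtain ⟨y, hy, he⟩ := hK.sInf_mem hne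
    rw [sphMin, ← he]
    exact h.2.2 y hy
  · exact (min_le_right _ _).trans (csInf_le hK.bddBelow ⟨x, hx, rfl⟩)
  · exact (le_csSup hK.bddAbove ⟨x, hx, rfl⟩).trans (le_max_right _ _)

lemma extend_le {g : ℝ → ℝ} (hg : Continuous g) (hT : 0 < T) (h : ∀ t ∈ Ico 0 T, 0 ≤ g t) :
    ∀ t ∈ Icc 0 T, 0 ≤ g t := by
  intro t ht
  rw [← closure_Ico hT.ne] at ht
  exact le_on_closure h continuousOn_const hg.continuousOn ht

lemma deriv_cont (h : Reg T ρ) {x : E (n + 1)} (hx : ‖x‖ = 1) :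
    Continuous (fun t => deriv (fun s => ρ s x) t) :=
  (time_smooth h.sm (ne_zero_of_unit hx)).continuous_deriv (by simp)

lemma flow_sign_pos (hΓ : GoodCone Γ) (hF : GoodF Γ F k) (hf : GoodPrescribed f k r₁ r₂) (hT : 0 < T)
    (hρ₀ : GoodInit ρ₀) (hadm : Admissible Γ ρ₀)
    (hsign : ∀ x : E (n + 1), ‖x‖ = 1 → ∀ κ : Fin n → ℝ, HasPrincCurv ρ₀ x κ →
      0 ≤ calF F f ρ₀ x κ) (h : IsFlowSol Γ F f T ρ ρ₀) :
    ∀ t ∈ Icc (0 : ℝ) T, ∀ x : E (n + 1), ‖x‖ = 1 → 0 ≤ deriv (fun s => ρ s x) t := by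
  have hR := flow_reg h
  have h1 := comparison hΓ hF hf (Reg.static (T := T) hρ₀) hR (by
    intro t ht x hx
    obtain ⟨κ, hκ, hp⟩ := hadm x hx
    refine ⟨κ, hκ, hp, ?_⟩
    simp only [deriv_const]
    exact hsign x hx κ hp) (flow_super h) (fun x hx => (h.2.2.2.2.2 x hx).ge)
  have h2 : ∀ s, 0 ≤ s → s ≤ T → ∀ t ∈ Icc 0 (T - s), ∀ x, ‖x‖ = 1 → ρ t x ≤ ρ (t + s) x := by
    intro s hs hsT
    refine comparison hΓ hF hf (hR.restrict (by linarith)) (hR.shift hs)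
      ((flow_sub h).restrict (by linarith)) ((flow_super h).shift hs) ?_
    intro x hx
    rw [zero_add, h.2.2.2.2.2 x hx]
    exact h1 s ⟨hs, hsT⟩ x hx
  intro t ht x hx
  refine extend_le (deriv_cont hR hx) hT ?_ t ht
  intro t ht
  refine deriv_nonneg_right ht.2 (time_deriv hR.sm (ne_zero_of_unit hx) t) ?_
  intro s hs
  have := h2 (s - t) (by linarith [hs.1]) (by linarith [hs.2, ht.1]) t
    ⟨ht.1, by linarith [hs.2]⟩ x hx
  simpa using this

lemma flow_sign_neg (hΓ : GoodCone Γ) (hF : GoodF Γ F k) (hf : GoodPrescribed f k r₁ r₂) (hT : 0 < T)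
    (hρ₀ : GoodInit ρ₀) (hadm : Admissible Γ ρ₀)
    (hsign : ∀ x : E (n + 1), ‖x‖ = 1 → ∀ κ : Fin n → ℝ, HasPrincCurv ρ₀ x κ →
      calF F f ρ₀ x κ ≤ 0) (h : IsFlowSol Γ F f T ρ ρ₀) :
    ∀ t ∈ Icc (0 : ℝ) T, ∀ x : E (n + 1), ‖x‖ = 1 → deriv (fun s => ρ s x) t ≤ 0 := by
  have hR := flow_reg h
  have h1 := comparison hΓ hF hf hR (Reg.static (T := T) hρ₀) (flow_sub h) (by
    intro t ht x hx
    obtain ⟨κ, hκ, hp⟩ := hadm x hx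
    refine ⟨κ, hκ, hp, ?_⟩
    simp only [deriv_const]
    exact hsign x hx κ hp) (fun x hx => (h.2.2.2.2.2 x hx).le)
  have h2 : ∀ s, 0 ≤ s → s ≤ T → ∀ t ∈ Icc 0 (T - s), ∀ x, ‖x‖ = 1 → ρ (t + s) x ≤ ρ t x := by
    intro s hs hsT
    refine comparison hΓ hF hf (hR.shift hs) (hR.restrict (by linarith))
      ((flow_sub h).shift hs) ((flow_super h).restrict (by linarith)) ?_
    intro x hx
    rw [zero_add, h.2.2.2.2.2 x hx]
    exact h1 s ⟨hs, hsT⟩ x hx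
  intro t ht x hx
  rw [← neg_nonneg]
  refine extend_le (deriv_cont hR hx).neg hT ?_ t ht
  intro t ht
  refine deriv_nonneg_right ht.2 (time_deriv hR.sm (ne_zero_of_unit hx) t).neg ?_
  intro s hs
  have := h2 (s - t) (by linarith [hs.1]) (by linarith [hs.2, ht.1]) t
    ⟨ht.1, by linarith [hs.2]⟩ x hx
  simpa using this

end

section
variable {n : ℕ} {T : ℝ} {ρ : ℝ → E (n + 1) → ℝ} {Γ : Set (Fin n → ℝ)} {F : (Fin n → ℝ) → ℝ}
  {f : E (n + 1) → ℝ} {k r₁ r₂ : ℝ} {ρ₀ : E (n + 1) → ℝ}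

lemma g_smooth (a lam : ℝ) : ContDiff ℝ (⊤ : ℕ∞) (fun t : ℝ => a * Real.exp (-lam * t)) := by
  fun_prop

lemma g_deriv (a lam t : ℝ) : deriv (fun t : ℝ => a * Real.exp (-lam * t)) t
    = -lam * (a * Real.exp (-lam * t)) := by
  have h1 : HasDerivAt (fun t : ℝ => -lam * t) (-lam) t := by
    simpa using (hasDerivAt_id t).const_mul (-lam)
  rw [((h1.exp).const_mul a).deriv]
  ring

lemma h_deriv (c r t : ℝ) : HasDerivAt (fun s : ℝ => Real.exp ((s - t) * c) * r) (r * c) t := by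
  have h1 : HasDerivAt (fun s : ℝ => (s - t) * c) c t := by
    simpa using ((hasDerivAt_id t).sub_const t).mul_const c
  have h2 := h1.exp.mul_const r
  exact h2.congr_deriv (by rw [sub_self, zero_mul, Real.exp_zero]; ring)

lemma decay_pos (hΓ : GoodCone Γ) (hF : GoodF Γ F k) (hf : GoodPrescribed f k r₁ r₂) (hT : 0 < T)
    (hk : k ≤ 1) (hρ₀ : GoodInit ρ₀) (hadm : Admissible Γ ρ₀)
    (hsign : ∀ x : E (n + 1), ‖x‖ = 1 → ∀ κ : Fin n → ℝ, HasPrincCurv ρ₀ x κ →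
      0 ≤ calF F f ρ₀ x κ) (h : IsFlowSol Γ F f T ρ ρ₀) {R₁ R₂ lam M : ℝ}
    (hR₁ : 0 < R₁) (hlam : 0 < lam) (hM0 : 0 ≤ M)
    (h₀ : ∀ x, ‖x‖ = 1 → R₁ ≤ ρ₀ x)
    (hlo : ∀ t ∈ Icc (0 : ℝ) T, ∀ x, ‖x‖ = 1 → R₁ ≤ ρ t x)
    (hhi : ∀ t ∈ Icc (0 : ℝ) T, ∀ x, ‖x‖ = 1 → ρ t x ≤ R₂)
    (hl : ∀ x : E (n + 1), ‖x‖ = 1 → ∀ r ∈ Icc (R₁ / 2) (2 * R₂), ∀ r' ∈ Icc (R₁ / 2) (2 * R₂),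
      ∀ s ∈ Icc (R₁ / 2) (2 * R₂), r ≤ r' → lam * (Real.log r' - Real.log r) ≤
        s ^ (k - 1) * (r' ^ (-k) * f (r' • x) - r ^ (-k) * f (r • x)))
    (hM : ∀ x : E (n + 1), ‖x‖ = 1 → ∀ κ : Fin n → ℝ,
      HasPrincCurv ρ₀ x κ → |calF F f ρ₀ x κ| ≤ M) :
    ∀ t ∈ Icc (0 : ℝ) T, ∀ x : E (n + 1), ‖x‖ = 1 →
      |deriv (fun s => ρ s x) t| ≤ R₂ / R₁ * M * Real.exp (-lam * t) := by
  have hR := flow_reg h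
  have hpos := flow_sign_pos hΓ hF hf hT hρ₀ hadm hsign h
  set m := M / R₁ with hm
  have hm0 : 0 ≤ m := div_nonneg hM0 hR₁.le
  have hA : ∀ t ∈ Icc (0 : ℝ) T, ∀ x, ‖x‖ = 1 → ρ t x ≤ Real.exp (t * m) * ρ₀ x := by
    have hsm : ContDiff ℝ (⊤ : ℕ∞) (fun t : ℝ => t * m) := by fun_prop
    refine comparison hΓ hF hf hR ((Reg.static (T := T) hρ₀).scale
      (c := fun t => Real.exp (t * m)) (by fun_prop) (fun t => Real.exp_pos _)) (flow_sub h)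
      (super_scale hΓ hF hk (Reg.static (T := T) hρ₀) (g := fun t => t * m) hsm
        (fun t ht => mul_nonneg ht.1 hm0) ?_) ?_
    · intro t ht x hx
      obtain ⟨κ, hκ, hp⟩ := hadm x hx
      have hp0 := hρ₀.2.2 x hx
      refine ⟨κ, hκ, hp, hsign x hx κ hp, 0, le_refl _, ?_, ?_⟩
      · have hge : ρ₀ x ≤ Real.exp (t * m) * ρ₀ x :=
          le_mul_of_one_le_left hp0.le (Real.one_le_exp (mul_nonneg ht.1 hm0))
        have hq := (Q_strict hf hx).monotoneOn (show ρ₀ x ∈ Ioi 0 from hp0)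
          (show Real.exp (t * m) * ρ₀ x ∈ Ioi 0 from hp0.trans_le hge) hge
        exact mul_nonneg (Real.rpow_nonneg (hp0.trans_le hge).le _) (sub_nonneg.mpr hq)
      · have hd : deriv (fun t : ℝ => t * m) t = m := by
          simpa using ((hasDerivAt_id t).mul_const m).deriv
        rw [hd, deriv_const, zero_div, zero_add, add_zero]
        exact div_le_div₀ hM0 ((le_abs_self _).trans (hM x hx κ hp)) hR₁ (h₀ x hx)
    · intro x hx
      simp [h.2.2.2.2.2 x hx]
  have hB : ∀ s, 0 < s → s ≤ T → s * m ≤ Real.log 2 → ∀ t ∈ Icc 0 (T - s), ∀ x, ‖x‖ = 1 →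
      ρ (t + s) x ≤ Real.exp (s * m * Real.exp (-lam * t)) * ρ t x := by
    intro s hs hsT hsm
    have ha0 : 0 ≤ s * m := mul_nonneg hs.le hm0
    refine comparison hΓ hF hf (hR.shift hs.le) ((hR.restrict (by linarith)).scale
      (c := fun t => Real.exp (s * m * Real.exp (-lam * t))) (by fun_prop)
      (fun t => Real.exp_pos _)) ((flow_sub h).shift hs.le)
      (super_scale hΓ hF hk (hR.restrict (by linarith))
        (g := fun t => s * m * Real.exp (-lam * t)) (g_smooth _ _)
        (fun t ht => mul_nonneg ha0 (Real.exp_pos _).le) ?_) ?_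
    · intro t ht x hx
      have ht' : t ∈ Icc 0 T := ⟨ht.1, by linarith [ht.2]⟩
      obtain ⟨κ, hκ, hp⟩ := h.2.2.2.1 t ht' x hx
      have he := h.2.2.2.2.1 t ht' x hx κ hp
      have hlo' := hlo t ht' x hx
      have hhi' := hhi t ht' x hx
      have hp0 : 0 < ρ t x := hR₁.trans_le hlo'
      set G := s * m * Real.exp (-lam * t) with hG
      have hG0 : 0 ≤ G := mul_nonneg ha0 (Real.exp_pos _).le
      have hG2 : G ≤ Real.log 2 := by
        refine (mul_le_of_le_one_right ha0 ?_).trans hsm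
        exact Real.exp_le_one_iff.mpr (by nlinarith [ht.1])
      have hc1 : 1 ≤ Real.exp G := Real.one_le_exp hG0
      have hc2 : Real.exp G ≤ 2 := by
        rw [← Real.exp_log (show (0:ℝ) < 2 by norm_num)]
        exact Real.exp_le_exp.mpr hG2
      have i1 : ρ t x ∈ Icc (R₁ / 2) (2 * R₂) := ⟨by linarith, by linarith⟩
      have i2 : Real.exp G * ρ t x ∈ Icc (R₁ / 2) (2 * R₂) := ⟨by nlinarith, by nlinarith⟩
      refine ⟨κ, hκ, hp, he ▸ hpos t ht' x hx, lam * G, mul_nonneg hlam.le hG0, ?_, ?_⟩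
      · have := hl x hx _ i1 _ i2 _ i2 (by nlinarith)
        rw [Real.log_mul (Real.exp_pos _).ne' hp0.ne', Real.log_exp, add_sub_cancel_right] at this
        exact this
      · rw [← he, g_deriv]
        linarith
    · intro x hx
      have := hA s ⟨hs.le, hsT⟩ x hx
      simpa [h.2.2.2.2.2 x hx] using this
  intro t ht x hx
  have hx0 := ne_zero_of_unit hx
  have key : ∀ t ∈ Icc 0 T, 0 ≤ R₂ / R₁ * M * Real.exp (-lam * t) - deriv (fun s => ρ s x) t := by
    refine extend_le (Continuous.sub (by fun_prop) (deriv_cont hR hx)) hT ?_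
    intro t ht
    have ht' : t ∈ Icc 0 T := ⟨ht.1, ht.2.le⟩
    have hl2 : 0 < Real.log 2 := Real.log_pos (by norm_num)
    have hδ : 0 < min (T - t) (Real.log 2 / (m + 1)) :=
      lt_min (by linarith [ht.2]) (div_pos hl2 (by linarith))
    have hd := (h_deriv (m * Real.exp (-lam * t)) (ρ t x) t).sub (time_deriv hR.sm hx0 t)
    have h1 := deriv_nonneg_right (b := t + min (T - t) (Real.log 2 / (m + 1)))
      (by linarith) hd (by
        intro s hs
        have e1 := hs.1
        have e2 : s - t < T - t := by linarith [hs.2, min_le_left (T - t) (Real.log 2 / (m + 1))]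
        have e3 : s - t < Real.log 2 / (m + 1) := by
          linarith [hs.2, min_le_right (T - t) (Real.log 2 / (m + 1))]
        rw [lt_div_iff₀ (by linarith)] at e3
        have := hB (s - t) (by linarith) (by linarith [ht.1]) (by nlinarith) t
          ⟨ht.1, by linarith⟩ x hx
        rw [add_sub_cancel, mul_assoc] at this
        simp only [Pi.sub_apply, sub_self, zero_mul, Real.exp_zero, one_mul]
        linarith)
    have h2 : ρ t x * (m * Real.exp (-lam * t)) ≤ R₂ * (m * Real.exp (-lam * t)) :=
      mul_le_mul_of_nonneg_right (hhi t ht' x hx) (mul_nonneg hm0 (Real.exp_pos _).le)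
    have h3 : R₂ / R₁ * M * Real.exp (-lam * t) = R₂ * (m * Real.exp (-lam * t)) := by
      rw [hm]; ring
    linarith
  rw [abs_of_nonneg (hpos t ht x hx)]
  linarith [key t ht]

lemma decay_neg (hΓ : GoodCone Γ) (hF : GoodF Γ F k) (hf : GoodPrescribed f k r₁ r₂) (hT : 0 < T)
    (hk : 1 < k) (hρ₀ : GoodInit ρ₀) (hadm : Admissible Γ ρ₀)
    (hsign : ∀ x : E (n + 1), ‖x‖ = 1 → ∀ κ : Fin n → ℝ, HasPrincCurv ρ₀ x κ →
      calF F f ρ₀ x κ ≤ 0) (h : IsFlowSol Γ F f T ρ ρ₀) {R₁ R₂ lam M : ℝ}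
    (hR₁ : 0 < R₁) (hlam : 0 < lam) (hM0 : 0 ≤ M)
    (h₀ : ∀ x, ‖x‖ = 1 → R₁ ≤ ρ₀ x)
    (hlo : ∀ t ∈ Icc (0 : ℝ) T, ∀ x, ‖x‖ = 1 → R₁ ≤ ρ t x)
    (hhi : ∀ t ∈ Icc (0 : ℝ) T, ∀ x, ‖x‖ = 1 → ρ t x ≤ R₂)
    (hl : ∀ x : E (n + 1), ‖x‖ = 1 → ∀ r ∈ Icc (R₁ / 2) (2 * R₂), ∀ r' ∈ Icc (R₁ / 2) (2 * R₂),
      ∀ s ∈ Icc (R₁ / 2) (2 * R₂), r ≤ r' → lam * (Real.log r' - Real.log r) ≤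
        s ^ (k - 1) * (r' ^ (-k) * f (r' • x) - r ^ (-k) * f (r • x)))
    (hM : ∀ x : E (n + 1), ‖x‖ = 1 → ∀ κ : Fin n → ℝ,
      HasPrincCurv ρ₀ x κ → |calF F f ρ₀ x κ| ≤ M) :
    ∀ t ∈ Icc (0 : ℝ) T, ∀ x : E (n + 1), ‖x‖ = 1 →
      |deriv (fun s => ρ s x) t| ≤ R₂ / R₁ * M * Real.exp (-lam * t) := by
  have hR := flow_reg h
  have hneg := flow_sign_neg hΓ hF hf hT hρ₀ hadm hsign h
  set m := M / R₁ with hm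
  have hm0 : 0 ≤ m := div_nonneg hM0 hR₁.le
  have hA : ∀ t ∈ Icc (0 : ℝ) T, ∀ x, ‖x‖ = 1 → Real.exp (t * (-m)) * ρ₀ x ≤ ρ t x := by
    have hsm : ContDiff ℝ (⊤ : ℕ∞) (fun t : ℝ => t * (-m)) := by fun_prop
    refine comparison hΓ hF hf ((Reg.static (T := T) hρ₀).scale
      (c := fun t => Real.exp (t * (-m))) (by fun_prop) (fun t => Real.exp_pos _)) hR
      (sub_scale hΓ hF hk (Reg.static (T := T) hρ₀) (g := fun t => t * (-m)) hsm
        (fun t ht => by nlinarith [ht.1]) ?_) (flow_super h) ?_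
    · intro t ht x hx
      obtain ⟨κ, hκ, hp⟩ := hadm x hx
      have hp0 := hρ₀.2.2 x hx
      refine ⟨κ, hκ, hp, hsign x hx κ hp, 0, le_refl _, ?_, ?_⟩
      · have hge : Real.exp (t * (-m)) * ρ₀ x ≤ ρ₀ x :=
          mul_le_of_le_one_left hp0.le (Real.exp_le_one_iff.mpr (by nlinarith [ht.1]))
        have hpp : 0 < Real.exp (t * (-m)) * ρ₀ x := mul_pos (Real.exp_pos _) hp0
        have hq := (Q_strict hf hx).monotoneOn
          (show Real.exp (t * (-m)) * ρ₀ x ∈ Ioi 0 from hpp) (show ρ₀ x ∈ Ioi 0 from hp0) hge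
        exact mul_nonneg (Real.rpow_nonneg hpp.le _) (sub_nonneg.mpr hq)
      · have hd : deriv (fun t : ℝ => t * (-m)) t = -m := by
          simpa using ((hasDerivAt_id t).mul_const (-m)).deriv
        rw [hd, deriv_const, zero_div, zero_add, sub_zero]
        have := div_le_div₀ hM0 ((neg_le_abs _).trans (hM x hx κ hp)) hR₁ (h₀ x hx)
        rw [neg_div] at this
        linarith
    · intro x hx
      simp [h.2.2.2.2.2 x hx]
  have hB : ∀ s, 0 < s → s ≤ T → s * m ≤ Real.log 2 → ∀ t ∈ Icc 0 (T - s), ∀ x, ‖x‖ = 1 →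
      Real.exp (s * (-m) * Real.exp (-lam * t)) * ρ t x ≤ ρ (t + s) x := by
    intro s hs hsT hsm
    have ha0 : 0 ≤ s * m := mul_nonneg hs.le hm0
    refine comparison hΓ hF hf ((hR.restrict (by linarith)).scale
      (c := fun t => Real.exp (s * (-m) * Real.exp (-lam * t))) (by fun_prop)
      (fun t => Real.exp_pos _)) (hR.shift hs.le)
      (sub_scale hΓ hF hk (hR.restrict (by linarith))
        (g := fun t => s * (-m) * Real.exp (-lam * t)) (g_smooth _ _)
        (fun t ht => mul_nonpos_of_nonpos_of_nonneg (by linarith) (Real.exp_pos _).le) ?_)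
      ((flow_super h).shift hs.le) ?_
    · intro t ht x hx
      have ht' : t ∈ Icc 0 T := ⟨ht.1, by linarith [ht.2]⟩
      obtain ⟨κ, hκ, hp⟩ := h.2.2.2.1 t ht' x hx
      have he := h.2.2.2.2.1 t ht' x hx κ hp
      have hlo' := hlo t ht' x hx
      have hhi' := hhi t ht' x hx
      have hp0 : 0 < ρ t x := hR₁.trans_le hlo'
      set G := s * (-m) * Real.exp (-lam * t) with hG
      have hG0 : G ≤ 0 := mul_nonpos_of_nonpos_of_nonneg (by linarith) (Real.exp_pos _).le
      have hG2 : -Real.log 2 ≤ G := by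
        have : s * m * Real.exp (-lam * t) ≤ Real.log 2 := by
          refine (mul_le_of_le_one_right ha0 ?_).trans hsm
          exact Real.exp_le_one_iff.mpr (by nlinarith [ht.1])
        rw [hG]; linarith
      have hc1 : Real.exp G ≤ 1 := Real.exp_le_one_iff.mpr hG0
      have hc2 : 1 / 2 ≤ Real.exp G := by
        have := Real.exp_le_exp.mpr hG2
        rw [Real.exp_neg, Real.exp_log (show (0:ℝ) < 2 by norm_num)] at this
        linarith
      have i1 : ρ t x ∈ Icc (R₁ / 2) (2 * R₂) := ⟨by linarith, by linarith⟩
      have i2 : Real.exp G * ρ t x ∈ Icc (R₁ / 2) (2 * R₂) := ⟨by nlinarith, by nlinarith⟩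
      refine ⟨κ, hκ, hp, he ▸ hneg t ht' x hx, lam * (-G),
        mul_nonneg hlam.le (by linarith), ?_, ?_⟩
      · have := hl x hx _ i2 _ i1 _ i2 (by nlinarith)
        rw [Real.log_mul (Real.exp_pos _).ne' hp0.ne', Real.log_exp, sub_add_cancel_right] at this
        exact this
      · rw [← he, g_deriv]
        linarith
    · intro x hx
      have := hA s ⟨hs.le, hsT⟩ x hx
      simpa [h.2.2.2.2.2 x hx] using this
  intro t ht x hx
  have hx0 := ne_zero_of_unit hx
  have key : ∀ t ∈ Icc 0 T, 0 ≤ R₂ / R₁ * M * Real.exp (-lam * t) + deriv (fun s => ρ s x) t := by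
    refine extend_le (Continuous.add (by fun_prop) (deriv_cont hR hx)) hT ?_
    intro t ht
    have ht' : t ∈ Icc 0 T := ⟨ht.1, ht.2.le⟩
    have hl2 : 0 < Real.log 2 := Real.log_pos (by norm_num)
    have hδ : 0 < min (T - t) (Real.log 2 / (m + 1)) :=
      lt_min (by linarith [ht.2]) (div_pos hl2 (by linarith))
    have hd := (time_deriv hR.sm hx0 t).sub (h_deriv ((-m) * Real.exp (-lam * t)) (ρ t x) t)
    have h1 := deriv_nonneg_right (b := t + min (T - t) (Real.log 2 / (m + 1)))
      (by linarith) hd (by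
        intro s hs
        have e1 := hs.1
        have e2 : s - t < T - t := by linarith [hs.2, min_le_left (T - t) (Real.log 2 / (m + 1))]
        have e3 : s - t < Real.log 2 / (m + 1) := by
          linarith [hs.2, min_le_right (T - t) (Real.log 2 / (m + 1))]
        rw [lt_div_iff₀ (by linarith)] at e3
        have := hB (s - t) (by linarith) (by linarith [ht.1]) (by nlinarith) t
          ⟨ht.1, by linarith⟩ x hx
        rw [add_sub_cancel, mul_assoc] at this
        simp only [Pi.sub_apply, sub_self, zero_mul, Real.exp_zero, one_mul]
        linarith)
    have h2 : ρ t x * (m * Real.exp (-lam * t)) ≤ R₂ * (m * Real.exp (-lam * t)) :=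
      mul_le_mul_of_nonneg_right (hhi t ht' x hx) (mul_nonneg hm0 (Real.exp_pos _).le)
    have h3 : R₂ / R₁ * M * Real.exp (-lam * t) = R₂ * (m * Real.exp (-lam * t)) := by
      rw [hm]; ring
    linarith
  rw [abs_of_nonpos (hneg t ht x hx)]
  linarith [key t ht]

end

/-- Proposition 3.2: sign of the velocity and its exponential decay:
there is `λ > 0` depending only on the data such that every admissible solution of the
flow with initial datum `ρ₀` has `∂ₜρ ≥ 0` (if `k ≤ 1`), `∂ₜρ ≤ 0` (if `k > 1`), and
`|∂ₜρ(t,·)| ≤ (R₂/R₁)·max|𝓕[ρ₀]|·e^{−λt}`. -/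
theorem stmt12 (n : ℕ) (hn : 2 ≤ n) (Γ : Set (Fin n → ℝ)) (hΓ : GoodCone Γ)
    (F : (Fin n → ℝ) → ℝ) (k : ℝ) (hk : 0 < k) (hF : GoodF Γ F k)
    (hFb : FVanishesOnBoundary Γ F)
    (f : E (n + 1) → ℝ) (r₁ r₂ : ℝ) (hf : GoodPrescribed f k r₁ r₂)
    (ρ₀ : E (n + 1) → ℝ) (hρ₀ : GoodInit ρ₀) (hadm : Admissible Γ ρ₀)
    (hsign₁ : k ≤ 1 → ∀ x : E (n + 1), ‖x‖ = 1 → ∀ κ : Fin n → ℝ,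
      HasPrincCurv ρ₀ x κ → 0 ≤ calF F f ρ₀ x κ)
    (hsign₂ : 1 < k → ∀ x : E (n + 1), ‖x‖ = 1 → ∀ κ : Fin n → ℝ,
      HasPrincCurv ρ₀ x κ → calF F f ρ₀ x κ ≤ 0) :
    ∃ lam : ℝ, 0 < lam ∧
      ∀ T : ℝ, 0 < T → ∀ ρ : ℝ → E (n + 1) → ℝ, IsFlowSol Γ F f T ρ ρ₀ →
        (k ≤ 1 → ∀ t ∈ Icc (0 : ℝ) T, ∀ x : E (n + 1), ‖x‖ = 1 →
          0 ≤ deriv (fun s => ρ s x) t) ∧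
        (1 < k → ∀ t ∈ Icc (0 : ℝ) T, ∀ x : E (n + 1), ‖x‖ = 1 →
          deriv (fun s => ρ s x) t ≤ 0) ∧
        (∀ M : ℝ, (∀ x : E (n + 1), ‖x‖ = 1 → ∀ κ : Fin n → ℝ,
            HasPrincCurv ρ₀ x κ → |calF F f ρ₀ x κ| ≤ M) →
          ∀ t ∈ Icc (0 : ℝ) T, ∀ x : E (n + 1), ‖x‖ = 1 →
            |deriv (fun s => ρ s x) t| ≤
              max r₂ (sphMax ρ₀) / min r₁ (sphMin ρ₀) * M * Real.exp (-lam * t)) := by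
  obtain ⟨hR₁, hb⟩ := init_bounds (r₂ := r₂) hρ₀ hf.2.2.2.1
  obtain ⟨x₀, hx₀⟩ := exists_unit (n := n)
  have h12 : min r₁ (sphMin ρ₀) ≤ max r₂ (sphMax ρ₀) := (hb x₀ hx₀).1.trans (hb x₀ hx₀).2
  obtain ⟨lam, hlam, hl⟩ := exists_lam hf (a := min r₁ (sphMin ρ₀) / 2)
    (b := 2 * max r₂ (sphMax ρ₀)) (by linarith) (by linarith)
  refine ⟨lam, hlam, fun T hT ρ h =>
    ⟨fun hk1 => flow_sign_pos hΓ hF hf hT hρ₀ hadm (hsign₁ hk1) h,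
      fun hk1 => flow_sign_neg hΓ hF hf hT hρ₀ hadm (hsign₂ hk1) h, fun M hM => ?_⟩⟩
  have hM0 : 0 ≤ M := by
    obtain ⟨κ, _, hp⟩ := hadm x₀ hx₀
    exact (abs_nonneg _).trans (hM x₀ hx₀ κ hp)
  have hlo := flow_ge hΓ hF hf h hR₁ (min_le_left _ _) (fun x hx => (hb x hx).1)
  have hhi := flow_le hΓ hF hf h (R := max r₂ (sphMax ρ₀)) (le_max_left _ _)
    (fun x hx => (hb x hx).2)
  rcases le_or_gt k 1 with hk1 | hk1
  · exact decay_pos hΓ hF hf hT hk1 hρ₀ hadm (hsign₁ hk1) h hR₁ hlam hM0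
      (fun x hx => (hb x hx).1) hlo hhi hl hM
  · exact decay_neg hΓ hF hf hT hk1 hρ₀ hadm (hsign₂ hk1) h hR₁ hlam hM0
      (fun x hx => (hb x hx).1) hlo hhi hl hM
end
end
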